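/- arXiv:1604.00107 — 3 statements merged into one kernel-verified Lean document; each statement's English description precedes it below -/
import Mathlib

section
/- Let σ_D, σ_E > 0 and A > 0. The supremum defining the secret-key capacity C_k(A) = sup_μ [ I(X;(Y,Z)) − I(X;Z) ], taken over probability measures μ on ℝ supported in [−A, A], is attained, and every maximizing probability measure μ₀ has finite support (i.e., μ₀ is a discrete measure concentrated on a finite set of points in [−A, A]). -/
open MeasureTheory ProbabilityTheory Real Filter Set
open scoped Classical

noncomputable section

/-- Kullback–Leibler divergence of `μ` from `ν` (valued in `EReal`; `⊤` when undefined). -/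
def klDiv {α : Type*} [MeasurableSpace α] (μ ν : Measure α) : EReal :=
  if μ ≪ ν ∧ Integrable (llr μ ν) μ then ((∫ x, llr μ ν x ∂μ : ℝ) : EReal) else ⊤

/-- Mutual information `I(U;V)` under `P`: the KL divergence of the joint law of `(U,V)`
from the product of its marginal laws. -/
def mutualInfo {Ω α β : Type*} [MeasurableSpace Ω] [MeasurableSpace α] [MeasurableSpace β]
    (P : Measure Ω) (U : Ω → α) (V : Ω → β) : EReal :=
  klDiv (P.map (fun ω => (U ω, V ω))) ((P.map U).prod (P.map V))

/-- Joint law of `(X, N_D, N_E)` where `X ~ μ`, `N_D ~ N(0,σD²)`, `N_E ~ N(0,σE²)` are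
mutually independent. -/
def chan (μ : Measure ℝ) (σD σE : ℝ) : Measure (ℝ × ℝ × ℝ) :=
  μ.prod ((gaussianReal 0 (σD ^ 2).toNNReal).prod (gaussianReal 0 (σE ^ 2).toNNReal))

/-- The channel input `X`. -/
def Xc : ℝ × ℝ × ℝ → ℝ := fun ω => ω.1
/-- The legitimate receiver's observation `Y = X + N_D`. -/
def Yc : ℝ × ℝ × ℝ → ℝ := fun ω => ω.1 + ω.2.1
/-- The eavesdropper's observation `Z = X + N_E`. -/
def Zc : ℝ × ℝ × ℝ → ℝ := fun ω => ω.1 + ω.2.2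

/-- The secret-key rate `I(X;(Y,Z)) − I(X;Z)` for input distribution `μ`. -/
def skRate (σD σE : ℝ) (μ : Measure ℝ) : EReal :=
  mutualInfo (chan μ σD σE) Xc (fun ω => (Yc ω, Zc ω)) - mutualInfo (chan μ σD σE) Xc Zc

/-- Secret-key capacity with amplitude constraint `A`. -/
def Ck (σD σE A : ℝ) : EReal :=
  sSup {r : EReal | ∃ μ : Measure ℝ, IsProbabilityMeasure μ ∧ μ (Set.Icc (-A) A)ᶜ = 0 ∧
    r = skRate σD σE μ}

open scoped NNReal ENNReal Topology

/-- Density at `t` of the law of `T ~ N(c x, c)` with respect to `N(0, c)`. -/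
def gker (c : ℝ≥0) (x t : ℝ) : ℝ := exp (x * t - c * x ^ 2 / 2)

/-- Density of the output law with respect to `N(0, c)` when the input has law `μ`. -/
def outDens (c : ℝ≥0) (μ : Measure ℝ) (t : ℝ) : ℝ := ∫ x, gker c x t ∂μ

/-- Mean of the log-likelihood of the output density when the input symbol is `x`. -/
def logMean (c : ℝ≥0) (μ : Measure ℝ) (x : ℝ) : ℝ :=
  ∫ t, gker c x t * log (outDens c μ t) ∂gaussianReal 0 c

/-- Mean of the log-likelihood of the output density of `ν` when the input has law `μ`. -/
def crossEnt (c : ℝ≥0) (μ ν : Measure ℝ) : ℝ :=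
  ∫ t, outDens c μ t * log (outDens c ν t) ∂gaussianReal 0 c

/-- Closed form of the Gaussian-channel mutual information. -/
def gaussInfo (c : ℝ≥0) (μ : Measure ℝ) : ℝ := c / 2 * ∫ x, x ^ 2 ∂μ - crossEnt c μ μ

lemma gker_pos (c : ℝ≥0) (x t : ℝ) : 0 < gker c x t := exp_pos _

lemma continuous_gker (c : ℝ≥0) : Continuous (fun p : ℝ × ℝ => gker c p.1 p.2) := by
  unfold gker; fun_prop

lemma measurable_gker_right (c : ℝ≥0) (x : ℝ) : Measurable (gker c x) :=
  ((continuous_gker c).comp (by fun_prop : Continuous fun t : ℝ => (x, t))).measurable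

lemma abs_log_gker_le (c : ℝ≥0) {A x : ℝ} (hx : |x| ≤ A) (t : ℝ) :
    |x * t - c * x ^ 2 / 2| ≤ A * |t| + c * A ^ 2 / 2 := by
  have h2 : x ^ 2 ≤ A ^ 2 := sq_le_sq' (abs_le.1 hx).1 (abs_le.1 hx).2
  calc |x * t - c * x ^ 2 / 2| ≤ |x * t| + |(c : ℝ) * x ^ 2 / 2| := abs_sub _ _
    _ = |x| * |t| + c * x ^ 2 / 2 := by
      rw [abs_mul, abs_of_nonneg (by positivity : 0 ≤ (c : ℝ) * x ^ 2 / 2)]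
    _ ≤ _ := by gcongr

lemma gker_le (c : ℝ≥0) {A x : ℝ} (hx : |x| ≤ A) (t : ℝ) :
    gker c x t ≤ exp (A * |t| + c * A ^ 2 / 2) :=
  exp_le_exp.2 ((le_abs_self _).trans (abs_log_gker_le c hx t))

lemma le_gker (c : ℝ≥0) {A x : ℝ} (hx : |x| ≤ A) (t : ℝ) :
    exp (-(A * |t| + c * A ^ 2 / 2)) ≤ gker c x t :=
  exp_le_exp.2 (neg_le_of_abs_le (abs_log_gker_le c hx t))

lemma ae_abs_le {A : ℝ} {μ : Measure ℝ} (hμ : μ (Icc (-A) A)ᶜ = 0) : ∀ᵐ x ∂μ, |x| ≤ A := by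
  filter_upwards [measure_eq_zero_iff_ae_notMem.1 hμ] with x hx
  simpa [abs_le] using hx

section Bounded

variable {A : ℝ} {μ : Measure ℝ} [IsProbabilityMeasure μ]

lemma integrable_gker_left (c : ℝ≥0) (hμ : μ (Icc (-A) A)ᶜ = 0) (t : ℝ) :
    Integrable (fun x => gker c x t) μ := by
  refine (integrable_const (exp (A * |t| + c * A ^ 2 / 2))).mono' ?_ ?_
  · exact ((continuous_gker c).comp
      (by fun_prop : Continuous fun x : ℝ => (x, t))).aestronglyMeasurable
  · filter_upwards [ae_abs_le hμ] with x hx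
    rw [norm_of_nonneg (gker_pos c x t).le]
    exact gker_le c hx t

lemma outDens_le (c : ℝ≥0) (hμ : μ (Icc (-A) A)ᶜ = 0) (t : ℝ) :
    outDens c μ t ≤ exp (A * |t| + c * A ^ 2 / 2) := by
  have := integral_mono_ae (integrable_gker_left c hμ t)
    (integrable_const (exp (A * |t| + c * A ^ 2 / 2)))
    ((ae_abs_le hμ).mono fun x hx => gker_le c hx t)
  simpa [outDens] using this

lemma le_outDens (c : ℝ≥0) (hμ : μ (Icc (-A) A)ᶜ = 0) (t : ℝ) :
    exp (-(A * |t| + c * A ^ 2 / 2)) ≤ outDens c μ t := by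
  have := integral_mono_ae (integrable_const (exp (-(A * |t| + c * A ^ 2 / 2))))
    (integrable_gker_left c hμ t)
    ((ae_abs_le hμ).mono fun x hx => le_gker c hx t)
  simpa [outDens] using this

lemma outDens_pos (c : ℝ≥0) (hμ : μ (Icc (-A) A)ᶜ = 0) (t : ℝ) : 0 < outDens c μ t :=
  (exp_pos _).trans_le (le_outDens c hμ t)

lemma abs_log_outDens_le (c : ℝ≥0) (hμ : μ (Icc (-A) A)ᶜ = 0) (t : ℝ) :
    |log (outDens c μ t)| ≤ A * |t| + c * A ^ 2 / 2 := by
  rw [abs_le]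
  exact ⟨(le_log_iff_exp_le (outDens_pos c hμ t)).2 (le_outDens c hμ t),
    (log_le_iff_le_exp (outDens_pos c hμ t)).2 (outDens_le c hμ t)⟩

lemma measurable_outDens (c : ℝ≥0) (μ : Measure ℝ) [SFinite μ] : Measurable (outDens c μ) :=
  (StronglyMeasurable.integral_prod_left'
    (continuous_gker c).stronglyMeasurable).measurable

lemma integrable_exp_mul_abs (c : ℝ≥0) (a k : ℝ) :
    Integrable (fun t => exp (a * |t| + k)) (gaussianReal 0 c) := by
  simp_rw [exp_add]
  refine Integrable.mul_const ?_ _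
  refine ((integrable_exp_mul_gaussianReal (μ := 0) (v := c) a).add
    (integrable_exp_mul_gaussianReal (μ := 0) (v := c) (-a))).mono' (by fun_prop) ?_
  refine ae_of_all _ fun t => ?_
  rw [norm_of_nonneg (exp_pos _).le]
  rcases abs_cases t with ⟨h, _⟩ | ⟨h, _⟩
  · simp only [h, Pi.add_apply]; linarith [exp_pos (-a * t)]
  · simp only [h, Pi.add_apply, mul_neg, neg_mul]; linarith [exp_pos (a * t)]

lemma integrable_of_abs_le_exp {c : ℝ≥0} {f : ℝ → ℝ} (hf : Measurable f) (a k : ℝ)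
    (h : ∀ t, |f t| ≤ exp (a * |t| + k)) : Integrable f (gaussianReal 0 c) :=
  (integrable_exp_mul_abs c a k).mono' hf.aestronglyMeasurable (ae_of_all _ h)

lemma abs_mul_le_exp {u v a b k l t : ℝ} (hu : |u| ≤ exp (a * |t| + k))
    (hv : |v| ≤ b * |t| + l) : |u * v| ≤ exp ((a + b) * |t| + (k + l)) := by
  rw [abs_mul]
  calc |u| * |v| ≤ exp (a * |t| + k) * exp (b * |t| + l) := by
        gcongr
        exact hv.trans ((le_add_of_nonneg_right zero_le_one).trans (add_one_le_exp _))
    _ = _ := by rw [← exp_add]; ring_nf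

lemma integrable_gker (c : ℝ≥0) (x : ℝ) : Integrable (gker c x) (gaussianReal 0 c) :=
  integrable_of_abs_le_exp (measurable_gker_right c x) |x| (c * |x| ^ 2 / 2) fun t => by
    rw [abs_of_pos (gker_pos c x t)]; exact gker_le c le_rfl t

lemma integrable_outDens (c : ℝ≥0) (hμ : μ (Icc (-A) A)ᶜ = 0) :
    Integrable (outDens c μ) (gaussianReal 0 c) :=
  integrable_of_abs_le_exp (measurable_outDens c μ) A (c * A ^ 2 / 2) fun t => by
    rw [abs_of_pos (outDens_pos c hμ t)]; exact outDens_le c hμ t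

lemma abs_gker_mul_log_le (c : ℝ≥0) (hμ : μ (Icc (-A) A)ᶜ = 0) {a x : ℝ} (hx : |x| ≤ a) (t : ℝ) :
    |gker c x t * log (outDens c μ t)| ≤
      exp ((a + A) * |t| + (c * a ^ 2 / 2 + c * A ^ 2 / 2)) :=
  abs_mul_le_exp (by rw [abs_of_pos (gker_pos c x t)]; exact gker_le c hx t)
    (abs_log_outDens_le c hμ t)

lemma abs_outDens_mul_log_le (c : ℝ≥0) (hμ : μ (Icc (-A) A)ᶜ = 0)
    {ν : Measure ℝ} [IsProbabilityMeasure ν] (hν : ν (Icc (-A) A)ᶜ = 0) (t : ℝ) :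
    |outDens c μ t * log (outDens c ν t)| ≤
      exp ((A + A) * |t| + (c * A ^ 2 / 2 + c * A ^ 2 / 2)) :=
  abs_mul_le_exp (by rw [abs_of_pos (outDens_pos c hμ t)]; exact outDens_le c hμ t)
    (abs_log_outDens_le c hν t)

lemma integrable_outDens_mul_log (c : ℝ≥0) (hμ : μ (Icc (-A) A)ᶜ = 0)
    {ν : Measure ℝ} [IsProbabilityMeasure ν] (hν : ν (Icc (-A) A)ᶜ = 0) :
    Integrable (fun t => outDens c μ t * log (outDens c ν t)) (gaussianReal 0 c) :=
  integrable_of_abs_le_exp ((measurable_outDens c μ).mul (measurable_outDens c ν).log)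
    _ _ (abs_outDens_mul_log_le c hμ hν)

end Bounded

lemma gaussianReal_eq_withDensity {v : ℝ≥0} (hv : v ≠ 0) (x : ℝ) :
    gaussianReal x v =
      (gaussianReal 0 v).withDensity (fun t => ENNReal.ofReal (gker v (x / v) t)) := by
  have hv' : (v : ℝ) ≠ 0 := by exact_mod_cast hv
  rw [gaussianReal_of_var_ne_zero _ hv, gaussianReal_of_var_ne_zero _ hv,
    ← withDensity_mul _ (measurable_gaussianPDF 0 v)
      (measurable_gker_right v (x / v)).ennreal_ofReal]
  congr 1
  ext t
  rw [Pi.mul_apply, gaussianPDF, gaussianPDF, ← ENNReal.ofReal_mul (gaussianPDFReal_nonneg _ _ _)]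
  congr 1
  rw [gaussianPDFReal, gaussianPDFReal, gker, mul_assoc _ (rexp _) (rexp _), ← exp_add]
  congr 2
  field_simp
  ring

lemma gaussianReal_mul_eq_withDensity {c : ℝ≥0} (hc : c ≠ 0) (x : ℝ) :
    gaussianReal (c * x) c =
      (gaussianReal 0 c).withDensity (fun t => ENNReal.ofReal (gker c x t)) := by
  have hc' : (c : ℝ) ≠ 0 := by exact_mod_cast hc
  rw [gaussianReal_eq_withDensity hc, mul_div_cancel_left₀ _ hc']

lemma integral_gker_mul {c : ℝ≥0} (hc : c ≠ 0) (x : ℝ) (f : ℝ → ℝ) :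
    ∫ t, gker c x t * f t ∂gaussianReal 0 c = ∫ t, f t ∂gaussianReal (c * x) c := by
  rw [gaussianReal_mul_eq_withDensity hc,
    integral_withDensity_eq_integral_toReal_smul
      (measurable_gker_right c x).ennreal_ofReal (by simp)]
  simp [ENNReal.toReal_ofReal (gker_pos c x _).le]

lemma integral_gker {c : ℝ≥0} (hc : c ≠ 0) (x : ℝ) :
    ∫ t, gker c x t ∂gaussianReal 0 c = 1 := by
  simpa using integral_gker_mul hc x (fun _ => 1)

lemma integral_gker_mul_id {c : ℝ≥0} (hc : c ≠ 0) (x : ℝ) :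
    ∫ t, gker c x t * t ∂gaussianReal 0 c = c * x := by
  rw [integral_gker_mul hc, integral_id_gaussianReal]

lemma integrable_abs_gaussianReal (m : ℝ) (c : ℝ≥0) :
    Integrable (fun t : ℝ => |t|) (gaussianReal m c) :=
  ((memLp_id_gaussianReal' (μ := m) (v := c) 1 (by simp)).integrable le_rfl).abs

lemma integral_abs_gaussianReal_le (m : ℝ) (c : ℝ≥0) :
    ∫ t, |t| ∂gaussianReal m c ≤ |m| + ∫ t, |t| ∂gaussianReal 0 c := by
  have h : gaussianReal m c = (gaussianReal 0 c).map (m + ·) := by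
    rw [gaussianReal_map_const_add, zero_add]
  have hi := integrable_abs_gaussianReal m c
  rw [h, integrable_map_measure (by fun_prop) (by fun_prop)] at hi
  rw [h, integral_map (by fun_prop) (by fun_prop)]
  calc ∫ t, |m + t| ∂gaussianReal 0 c ≤ ∫ t, (|m| + |t|) ∂gaussianReal 0 c :=
        integral_mono hi ((integrable_const _).add (integrable_abs_gaussianReal 0 c))
          fun t => abs_add_le _ _
    _ = _ := by
      rw [integral_add (integrable_const _) (integrable_abs_gaussianReal 0 c)]; simp

lemma abs_logMean_le {c : ℝ≥0} (hc : c ≠ 0) {A : ℝ} (hA : 0 ≤ A) {μ : Measure ℝ}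
    [IsProbabilityMeasure μ] (hμ : μ (Icc (-A) A)ᶜ = 0) (x : ℝ) :
    |logMean c μ x| ≤
      A * (c * |x| + ∫ t, |t| ∂gaussianReal 0 c) + c * A ^ 2 / 2 := by
  have hi : Integrable (fun t : ℝ => A * |t| + c * A ^ 2 / 2) (gaussianReal (c * x) c) :=
    ((integrable_abs_gaussianReal _ c).const_mul A).add (integrable_const _)
  have h1 : |logMean c μ x| ≤ ∫ t, (A * |t| + c * A ^ 2 / 2) ∂gaussianReal (c * x) c := by
    rw [logMean, integral_gker_mul hc, ← norm_eq_abs]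
    exact norm_integral_le_of_norm_le hi (ae_of_all _ (abs_log_outDens_le c hμ))
  refine h1.trans ?_
  rw [integral_add ((integrable_abs_gaussianReal _ c).const_mul A) (integrable_const _),
    integral_const_mul]
  have := integral_abs_gaussianReal_le (c * x) c
  rw [abs_mul, NNReal.abs_eq] at this
  simp only [integral_const, probReal_univ, one_smul]
  gcongr

section Fubini

variable {A : ℝ} {μ ν : Measure ℝ} [IsProbabilityMeasure μ] [IsProbabilityMeasure ν]

lemma integrable_prod_gker_mul_log (c : ℝ≥0) (hμ : μ (Icc (-A) A)ᶜ = 0)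
    (hν : ν (Icc (-A) A)ᶜ = 0) :
    Integrable (fun p : ℝ × ℝ => gker c p.1 p.2 * log (outDens c ν p.2))
      (μ.prod (gaussianReal 0 c)) := by
  refine ((integrable_exp_mul_abs c (A + A) (c * A ^ 2 / 2 + c * A ^ 2 / 2)).comp_snd μ).mono'
    ?_ ?_
  · exact ((continuous_gker c).measurable.mul
      ((measurable_outDens c ν).comp measurable_snd).log).aestronglyMeasurable
  · filter_upwards [Measure.quasiMeasurePreserving_fst.ae (ae_abs_le hμ)] with p hp
    exact abs_gker_mul_log_le c hν hp p.2

lemma integrable_prod_gker (c : ℝ≥0) (hμ : μ (Icc (-A) A)ᶜ = 0) :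
    Integrable (fun p : ℝ × ℝ => gker c p.1 p.2) (μ.prod (gaussianReal 0 c)) := by
  refine ((integrable_exp_mul_abs c A (c * A ^ 2 / 2)).comp_snd μ).mono'
    (continuous_gker c).aestronglyMeasurable ?_
  filter_upwards [Measure.quasiMeasurePreserving_fst.ae (ae_abs_le hμ)] with p hp
  rw [norm_of_nonneg (gker_pos c _ _).le]
  exact gker_le c hp p.2

lemma integrable_logMean (c : ℝ≥0) (hμ : μ (Icc (-A) A)ᶜ = 0) (hν : ν (Icc (-A) A)ᶜ = 0) :
    Integrable (logMean c ν) μ :=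
  (integrable_prod_gker_mul_log c hμ hν).integral_prod_left

lemma crossEnt_eq_integral_logMean (c : ℝ≥0) (hμ : μ (Icc (-A) A)ᶜ = 0)
    (hν : ν (Icc (-A) A)ᶜ = 0) : crossEnt c μ ν = ∫ x, logMean c ν x ∂μ := by
  unfold logMean
  rw [integral_integral_swap (integrable_prod_gker_mul_log c hμ hν)]
  simp_rw [integral_mul_const]
  rfl

lemma integral_outDens {c : ℝ≥0} (hc : c ≠ 0) (hμ : μ (Icc (-A) A)ᶜ = 0) :
    ∫ t, outDens c μ t ∂gaussianReal 0 c = 1 := by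
  unfold outDens
  rw [← integral_integral_swap (integrable_prod_gker c hμ)]
  simp [integral_gker hc]

lemma crossEnt_le_crossEnt_self {c : ℝ≥0} (hc : c ≠ 0) (hμ : μ (Icc (-A) A)ᶜ = 0)
    (hν : ν (Icc (-A) A)ᶜ = 0) : crossEnt c μ ν ≤ crossEnt c μ μ := by
  have hle : ∀ t, outDens c μ t * log (outDens c ν t) ≤
      outDens c μ t * log (outDens c μ t) + (outDens c ν t - outDens c μ t) := fun t => by
    have hp := outDens_pos c hμ t
    have hq := outDens_pos c hν t
    have := log_le_sub_one_of_pos (div_pos hq hp)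
    rw [log_div hq.ne' hp.ne'] at this
    have h2 := mul_le_mul_of_nonneg_left this hp.le
    rw [mul_sub, mul_sub, mul_div_cancel₀ _ hp.ne'] at h2
    linarith
  have hq := integrable_outDens c hν
  have hp := integrable_outDens c hμ
  have hs := integrable_outDens_mul_log c hμ hμ
  have := integral_mono (integrable_outDens_mul_log c hμ hν) (hs.add (hq.sub hp)) hle
  rw [integral_add' hs (hq.sub hp), integral_sub' hq hp, integral_outDens hc hμ,
    integral_outDens hc hν] at this
  simpa [crossEnt] using this

end Fubini

/-- The mixture `(1 - s) μ + s δ_x`. -/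
def mixDirac (μ : Measure ℝ) (x s : ℝ) : Measure ℝ :=
  ENNReal.ofReal (1 - s) • μ + ENNReal.ofReal s • Measure.dirac x

lemma isProbabilityMeasure_mixDirac (μ : Measure ℝ) [IsProbabilityMeasure μ] (x : ℝ) {s : ℝ}
    (h0 : 0 ≤ s) (h1 : s ≤ 1) : IsProbabilityMeasure (mixDirac μ x s) := by
  constructor
  simp only [mixDirac, Measure.add_apply, Measure.smul_apply, measure_univ, smul_eq_mul, mul_one]
  rw [← ENNReal.ofReal_add (by linarith) h0]
  simp

lemma mixDirac_compl_Icc {A : ℝ} {μ : Measure ℝ} (hμ : μ (Icc (-A) A)ᶜ = 0) {x : ℝ}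
    (hx : x ∈ Icc (-A) A) (s : ℝ) : mixDirac μ x s (Icc (-A) A)ᶜ = 0 := by
  simp only [mixDirac, Measure.add_apply, Measure.smul_apply, hμ, smul_zero, zero_add,
    Measure.dirac_apply' x measurableSet_Icc.compl]
  simp [hx]

lemma integral_mixDirac {μ : Measure ℝ} {x s : ℝ} (h0 : 0 ≤ s) (h1 : s ≤ 1) {f : ℝ → ℝ}
    (hf : Integrable f μ) : ∫ y, f y ∂mixDirac μ x s = (1 - s) * ∫ y, f y ∂μ + s * f x := by
  rw [mixDirac, integral_add_measure (hf.smul_measure (by simp))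
    ((integrable_dirac (by simp)).smul_measure (by simp)), integral_smul_measure,
    integral_smul_measure, integral_dirac]
  simp [ENNReal.toReal_ofReal h0, ENNReal.toReal_ofReal (sub_nonneg.2 h1)]

lemma tendsto_logMean_mixDirac {c : ℝ≥0} {A : ℝ} {μ : Measure ℝ} [IsProbabilityMeasure μ]
    (hμ : μ (Icc (-A) A)ᶜ = 0) {x : ℝ} (hx : x ∈ Icc (-A) A) :
    Tendsto (fun s => logMean c (mixDirac μ x s) x) (𝓝[>] 0) (𝓝 (logMean c μ x)) := by
  have hev : ∀ᶠ s : ℝ in 𝓝[>] 0, 0 ≤ s ∧ s ≤ 1 := by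
    filter_upwards [Ioc_mem_nhdsGT (zero_lt_one' ℝ)] with s hs using ⟨hs.1.le, hs.2⟩
  refine tendsto_integral_filter_of_dominated_convergence
    (fun t => exp ((A + A) * |t| + (c * A ^ 2 / 2 + c * A ^ 2 / 2))) ?_ ?_
    (integrable_exp_mul_abs c _ _) ?_
  · filter_upwards [hev] with s hs
    have := isProbabilityMeasure_mixDirac μ x hs.1 hs.2
    exact ((measurable_gker_right c x).mul (measurable_outDens c _).log).aestronglyMeasurable
  · filter_upwards [hev] with s hs
    have := isProbabilityMeasure_mixDirac μ x hs.1 hs.2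
    exact ae_of_all _ (abs_gker_mul_log_le c (mixDirac_compl_Icc hμ hx s) (abs_le.2 hx))
  · refine ae_of_all _ fun t => Tendsto.const_mul _ (Tendsto.log ?_ (outDens_pos c hμ t).ne')
    have h1 : Tendsto (fun s : ℝ => (1 - s) * outDens c μ t + s * gker c x t) (𝓝[>] 0)
        (𝓝 ((1 - 0) * outDens c μ t + 0 * gker c x t)) :=
      (Continuous.tendsto (by fun_prop) 0).mono_left nhdsWithin_le_nhds
    simp only [sub_zero, one_mul, zero_mul, add_zero] at h1
    refine h1.congr' ?_
    filter_upwards [hev] with s hs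
    exact (integral_mixDirac hs.1 hs.2 (integrable_gker_left c hμ t)).symm

/-- The difference of two Gaussian mutual informations. -/
def gaussRate (c₁ c₂ : ℝ≥0) (μ : Measure ℝ) : ℝ := gaussInfo c₁ μ - gaussInfo c₂ μ

/-- The first variation of `gaussRate` at `μ` in the direction of the point mass at `x`. -/
def score (c₁ c₂ : ℝ≥0) (μ : Measure ℝ) (x : ℝ) : ℝ :=
  ((c₁ : ℝ) - c₂) / 2 * x ^ 2 - logMean c₁ μ x + logMean c₂ μ x

section KKT

variable {c₁ c₂ : ℝ≥0} {A : ℝ} {μ : Measure ℝ} [IsProbabilityMeasure μ]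

lemma integrable_sq (hμ : μ (Icc (-A) A)ᶜ = 0) : Integrable (fun x : ℝ => x ^ 2) μ := by
  refine (integrable_const (A ^ 2)).mono' (by fun_prop) ?_
  filter_upwards [ae_abs_le hμ] with x hx
  rw [norm_of_nonneg (sq_nonneg x)]
  exact sq_le_sq' (abs_le.1 hx).1 (abs_le.1 hx).2

lemma integrable_score (hμ : μ (Icc (-A) A)ᶜ = 0) : Integrable (score c₁ c₂ μ) μ :=
  (((integrable_sq hμ).const_mul _).sub (integrable_logMean c₁ hμ hμ)).add
    (integrable_logMean c₂ hμ hμ)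

lemma gaussRate_eq (μ : Measure ℝ) : gaussRate c₁ c₂ μ =
    ((c₁ : ℝ) - c₂) / 2 * ∫ x, x ^ 2 ∂μ - crossEnt c₁ μ μ + crossEnt c₂ μ μ := by
  unfold gaussRate gaussInfo; ring

lemma integral_score (hμ : μ (Icc (-A) A)ᶜ = 0) :
    ∫ x, score c₁ c₂ μ x ∂μ = gaussRate c₁ c₂ μ := by
  have h1 := (integrable_sq hμ).const_mul (((c₁ : ℝ) - c₂) / 2)
  have h2 := integrable_logMean c₁ hμ hμ
  have h3 : Integrable (fun x => ((c₁ : ℝ) - c₂) / 2 * x ^ 2 - logMean c₁ μ x) μ := h1.sub h2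
  calc ∫ x, score c₁ c₂ μ x ∂μ = ((c₁ : ℝ) - c₂) / 2 * ∫ x, x ^ 2 ∂μ -
        ∫ x, logMean c₁ μ x ∂μ + ∫ x, logMean c₂ μ x ∂μ := by
        rw [← integral_const_mul, ← integral_sub h1 h2,
          ← integral_add h3 (integrable_logMean c₂ hμ hμ)]
        rfl
    _ = _ := by
      rw [gaussRate_eq, crossEnt_eq_integral_logMean c₁ hμ hμ,
        crossEnt_eq_integral_logMean c₂ hμ hμ]

lemma score_le_gaussRate (hc₁ : c₁ ≠ 0) (hc₂ : c₂ ≠ 0) (hμ : μ (Icc (-A) A)ᶜ = 0)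
    (hmax : ∀ ν : Measure ℝ, IsProbabilityMeasure ν → ν (Icc (-A) A)ᶜ = 0 →
      gaussRate c₁ c₂ ν ≤ gaussRate c₁ c₂ μ) {x : ℝ} (hx : x ∈ Icc (-A) A) :
    score c₁ c₂ μ x ≤ gaussRate c₁ c₂ μ := by
  have hlim : Tendsto (fun s => ((c₁ : ℝ) - c₂) / 2 * x ^ 2 - logMean c₁ (mixDirac μ x s) x +
      logMean c₂ μ x) (𝓝[>] 0) (𝓝 (score c₁ c₂ μ x)) :=
    ((tendsto_logMean_mixDirac hμ hx).const_sub _).add_const _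
  refine le_of_tendsto hlim ?_
  filter_upwards [Ioc_mem_nhdsGT (zero_lt_one' ℝ)] with s hs
  have hp := isProbabilityMeasure_mixDirac μ x hs.1.le hs.2
  have hm := mixDirac_compl_Icc hμ hx s
  have hR := hmax _ hp hm
  have e1 : crossEnt c₁ (mixDirac μ x s) (mixDirac μ x s) = (1 - s) *
      crossEnt c₁ μ (mixDirac μ x s) + s * logMean c₁ (mixDirac μ x s) x := by
    rw [crossEnt_eq_integral_logMean c₁ hm hm, crossEnt_eq_integral_logMean c₁ hμ hm,
      integral_mixDirac hs.1.le hs.2 (integrable_logMean c₁ hμ hm)]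
  have e2 : crossEnt c₂ (mixDirac μ x s) μ = (1 - s) * crossEnt c₂ μ μ +
      s * logMean c₂ μ x := by
    rw [crossEnt_eq_integral_logMean c₂ hm hμ, crossEnt_eq_integral_logMean c₂ hμ hμ,
      integral_mixDirac hs.1.le hs.2 (integrable_logMean c₂ hμ hμ)]
  have g1 := mul_le_mul_of_nonneg_left (crossEnt_le_crossEnt_self hc₁ hμ hm)
    (sub_nonneg.2 hs.2)
  have g2 := crossEnt_le_crossEnt_self hc₂ hm hμ
  rw [gaussRate_eq (mixDirac μ x s), integral_mixDirac hs.1.le hs.2 (integrable_sq hμ)] at hR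
  have hRμ := gaussRate_eq (c₁ := c₁) (c₂ := c₂) μ
  refine le_of_mul_le_mul_left ?_ hs.1
  have : (1 - s) * gaussRate c₁ c₂ μ = (1 - s) * (((c₁ : ℝ) - c₂) / 2 * ∫ x, x ^ 2 ∂μ -
    crossEnt c₁ μ μ + crossEnt c₂ μ μ) := by rw [hRμ]
  linarith

lemma ae_score_eq (hc₁ : c₁ ≠ 0) (hc₂ : c₂ ≠ 0) (hμ : μ (Icc (-A) A)ᶜ = 0)
    (hmax : ∀ ν : Measure ℝ, IsProbabilityMeasure ν → ν (Icc (-A) A)ᶜ = 0 →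
      gaussRate c₁ c₂ ν ≤ gaussRate c₁ c₂ μ) :
    ∀ᵐ x ∂μ, score c₁ c₂ μ x = gaussRate c₁ c₂ μ := by
  have hi : Integrable (fun x => gaussRate c₁ c₂ μ - score c₁ c₂ μ x) μ :=
    (integrable_const _).sub (integrable_score hμ)
  have h0 : 0 ≤ᵐ[μ] fun x => gaussRate c₁ c₂ μ - score c₁ c₂ μ x := by
    filter_upwards [ae_abs_le hμ] with x hx
    exact sub_nonneg.2 (score_le_gaussRate hc₁ hc₂ hμ hmax (abs_le.1 hx))
  have hz : ∫ x, (gaussRate c₁ c₂ μ - score c₁ c₂ μ x) ∂μ = 0 := by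
    rw [integral_sub (integrable_const _) (integrable_score hμ), integral_score hμ]
    simp
  filter_upwards [(integral_eq_zero_iff_of_nonneg_ae h0 hi).1 hz] with x hx
  exact (sub_eq_zero.1 hx).symm

end KKT

lemma analyticOnNhd_integral_exp_mul_of_nonneg {c : ℝ≥0} {g : ℝ → ℝ} (hg : Measurable g)
    (h0 : ∀ t, 0 ≤ g t) {b l : ℝ} (hb : ∀ t, |g t| ≤ b * |t| + l) :
    AnalyticOnNhd ℝ (fun x => ∫ t, exp (x * t) * g t ∂gaussianReal 0 c) univ := by
  set m := (gaussianReal 0 c).withDensity (fun t => ENNReal.ofReal (g t))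
  have hmgf : mgf id m = fun x => ∫ t, exp (x * t) * g t ∂gaussianReal 0 c := by
    ext x
    rw [mgf, integral_withDensity_eq_integral_toReal_smul hg.ennreal_ofReal (by simp)]
    simp [ENNReal.toReal_ofReal (h0 _), mul_comm]
  have hset : integrableExpSet id m = univ := by
    refine eq_univ_of_forall fun x => ?_
    change Integrable (fun t => exp (x * id t)) m
    rw [integrable_withDensity_iff_integrable_smul' hg.ennreal_ofReal (by simp)]
    simp only [ENNReal.toReal_ofReal (h0 _), smul_eq_mul, id]
    refine integrable_of_abs_le_exp (by fun_prop) (|x| + b) (0 + l) fun t => ?_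
    rw [mul_comm]
    refine abs_mul_le_exp ?_ (hb t)
    rw [abs_of_pos (exp_pos _), add_zero, ← abs_mul]
    exact exp_le_exp.2 (le_abs_self _)
  have := analyticOnNhd_mgf (X := id) (μ := m)
  rwa [hset, interior_univ, hmgf] at this

lemma analyticOnNhd_integral_gker_mul {c : ℝ≥0} {g : ℝ → ℝ} (hg : Measurable g)
    {b l : ℝ} (hb : ∀ t, |g t| ≤ b * |t| + l) :
    AnalyticOnNhd ℝ (fun x => ∫ t, gker c x t * g t ∂gaussianReal 0 c) univ := by
  have hp : ∀ t, |max (g t) 0| ≤ b * |t| + l := fun t =>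
    (by rw [abs_of_nonneg (le_max_right _ _)]; exact max_le (le_abs_self _) (abs_nonneg _) :
      |max (g t) 0| ≤ |g t|).trans (hb t)
  have hn : ∀ t, |max (-g t) 0| ≤ b * |t| + l := fun t =>
    (by rw [abs_of_nonneg (le_max_right _ _)]; exact max_le (neg_le_abs _) (abs_nonneg _) :
      |max (-g t) 0| ≤ |g t|).trans (hb t)
  have hint : ∀ {f : ℝ → ℝ}, Measurable f → (∀ t, |f t| ≤ b * |t| + l) → ∀ x,
      Integrable (fun t => exp (x * t) * f t) (gaussianReal 0 c) := fun hf hfb x => by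
    refine integrable_of_abs_le_exp (by fun_prop) (|x| + b) (0 + l) fun t => ?_
    refine abs_mul_le_exp ?_ (hfb t)
    rw [abs_of_pos (exp_pos _), add_zero, ← abs_mul]
    exact exp_le_exp.2 (le_abs_self _)
  have key : (fun x => ∫ t, gker c x t * g t ∂gaussianReal 0 c) = fun x =>
      exp (-(c * x ^ 2 / 2)) * ((∫ t, exp (x * t) * max (g t) 0 ∂gaussianReal 0 c) -
        ∫ t, exp (x * t) * max (-g t) 0 ∂gaussianReal 0 c) := by
    ext x
    rw [← integral_sub (hint (by fun_prop) hp x) (hint (by fun_prop) hn x), ← integral_const_mul]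
    congr 1
    ext t
    have : g t = max (g t) 0 - max (-g t) 0 := (max_zero_sub_max_neg_zero_eq_self (g t)).symm
    rw [← mul_sub, ← this, gker, sub_eq_neg_add, exp_add, mul_assoc]
  rw [key]
  have hq : AnalyticOnNhd ℝ (fun x : ℝ => exp (-(c * x ^ 2 / 2))) univ := fun x _ => by
    fun_prop
  exact hq.mul ((analyticOnNhd_integral_exp_mul_of_nonneg (by fun_prop)
      (fun t => le_max_right _ _) hp).sub
    (analyticOnNhd_integral_exp_mul_of_nonneg (by fun_prop) (fun t => le_max_right _ _) hn))

lemma analyticOnNhd_score (c₁ c₂ : ℝ≥0) {A : ℝ} {μ : Measure ℝ} [IsProbabilityMeasure μ]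
    (hμ : μ (Icc (-A) A)ᶜ = 0) : AnalyticOnNhd ℝ (score c₁ c₂ μ) univ := by
  have hq : AnalyticOnNhd ℝ (fun x : ℝ => ((c₁ : ℝ) - c₂) / 2 * x ^ 2) univ := fun x _ => by
    fun_prop
  exact (hq.sub (analyticOnNhd_integral_gker_mul (measurable_outDens c₁ μ).log
    (abs_log_outDens_le c₁ hμ))).add (analyticOnNhd_integral_gker_mul
      (measurable_outDens c₂ μ).log (abs_log_outDens_le c₂ hμ))

lemma exists_lt_quadratic {a : ℝ} (ha : 0 < a) (B C : ℝ) :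
    ∃ x : ℝ, B * |x| + C < a * x ^ 2 := by
  refine ⟨(|B| + |C| + 1) / a + 1, ?_⟩
  set x := (|B| + |C| + 1) / a + 1 with hx
  have h1 : 1 ≤ x := by rw [hx]; linarith [(by positivity : 0 ≤ (|B| + |C| + 1) / a)]
  have h2 : a * x = |B| + |C| + 1 + a := by rw [hx]; field_simp
  rw [abs_of_pos (by linarith)]
  have h3 : a * x ^ 2 = (|B| + |C| + 1 + a) * x := by rw [← h2]; ring
  rw [h3]
  nlinarith [le_abs_self B, le_abs_self C, abs_nonneg C]

lemma finite_setOf_score_eq {c₁ c₂ : ℝ≥0} (hc₁ : c₁ ≠ 0) (hc₂ : c₂ ≠ 0) (hlt : c₂ < c₁) {A : ℝ}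
    (hA : 0 ≤ A) {μ : Measure ℝ} [IsProbabilityMeasure μ] (hμ : μ (Icc (-A) A)ᶜ = 0) (R : ℝ) :
    {x ∈ Icc (-A) A | score c₁ c₂ μ x = R}.Finite := by
  by_contra hinf
  obtain ⟨z, -, hz⟩ := Set.Infinite.exists_accPt_of_subset_isCompact hinf
    (isCompact_Icc (a := -A) (b := A)) (fun x hx => hx.1)
  have hfreq : ∃ᶠ x in 𝓝[≠] z, score c₁ c₂ μ x = (fun _ => R) x :=
    (accPt_iff_frequently_nhdsNE.1 hz).mono fun x hx => hx.2
  have hconst := (analyticOnNhd_score c₁ c₂ hμ).eqOn_of_preconnected_of_frequently_eq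
    analyticOnNhd_const isPreconnected_univ (mem_univ z) hfreq
  have ha : 0 < ((c₁ : ℝ) - c₂) / 2 := by
    have : (c₂ : ℝ) < c₁ := by exact_mod_cast hlt
    linarith
  obtain ⟨x, hx⟩ := exists_lt_quadratic ha (A * c₁ + A * c₂)
    (A * (∫ t, |t| ∂gaussianReal 0 c₁) + c₁ * A ^ 2 / 2 +
      (A * (∫ t, |t| ∂gaussianReal 0 c₂) + c₂ * A ^ 2 / 2) + R)
  have h0 : score c₁ c₂ μ x = R := hconst (mem_univ x)
  have h1 := (abs_le.1 (abs_logMean_le hc₁ hA hμ x)).2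
  have h2 := (abs_le.1 (abs_logMean_le hc₂ hA hμ x)).1
  unfold score at h0
  linarith

lemma exists_finset_of_isMax {c₁ c₂ : ℝ≥0} (hc₁ : c₁ ≠ 0) (hc₂ : c₂ ≠ 0) (hlt : c₂ < c₁) {A : ℝ}
    (hA : 0 ≤ A) {μ : Measure ℝ} [IsProbabilityMeasure μ] (hμ : μ (Icc (-A) A)ᶜ = 0)
    (hmax : ∀ ν : Measure ℝ, IsProbabilityMeasure ν → ν (Icc (-A) A)ᶜ = 0 →
      gaussRate c₁ c₂ ν ≤ gaussRate c₁ c₂ μ) :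
    ∃ S : Finset ℝ, (S : Set ℝ) ⊆ Icc (-A) A ∧ μ (S : Set ℝ)ᶜ = 0 := by
  have hfin := finite_setOf_score_eq hc₁ hc₂ hlt hA hμ (gaussRate c₁ c₂ μ)
  refine ⟨hfin.toFinset, by rw [hfin.coe_toFinset]; exact fun x hx => hx.1, ?_⟩
  rw [hfin.coe_toFinset, measure_eq_zero_iff_ae_notMem]
  filter_upwards [ae_abs_le hμ, ae_score_eq hc₁ hc₂ hμ hmax] with x hx hs
  exact fun h => h ⟨abs_le.1 hx, hs⟩

section Continuity

variable {A : ℝ}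

lemma map_val_compl_Icc (μ : Measure (Icc (-A) A)) :
    μ.map Subtype.val (Icc (-A) A)ᶜ = 0 := by
  rw [Measure.map_apply measurable_subtype_coe measurableSet_Icc.compl]
  simp

lemma continuous_integral_probabilityMeasure {X : Type*} [TopologicalSpace X] [CompactSpace X]
    [MeasurableSpace X] [OpensMeasurableSpace X] {f : X → ℝ} (hf : Continuous f) :
    Continuous fun μ : ProbabilityMeasure X => ∫ x, f x ∂(μ : Measure X) :=
  continuous_iff_continuousAt.2 fun _ =>
    ProbabilityMeasure.tendsto_iff_forall_integral_tendsto.1 tendsto_id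
      (BoundedContinuousFunction.mkOfCompact ⟨f, hf⟩)

lemma continuous_integral_map_val {f : ℝ → ℝ} (hf : Continuous f) :
    Continuous fun μ : ProbabilityMeasure (Icc (-A) A) =>
      ∫ x, f x ∂((μ : Measure (Icc (-A) A)).map Subtype.val) := by
  have := continuous_integral_probabilityMeasure
    (hf.comp (continuous_subtype_val (p := (· ∈ Icc (-A) A))))
  refine this.congr fun μ => ?_
  rw [integral_map measurable_subtype_coe.aemeasurable hf.aestronglyMeasurable]
  rfl

lemma continuous_crossEnt_self (c : ℝ≥0) :
    Continuous fun μ : ProbabilityMeasure (Icc (-A) A) =>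
      crossEnt c ((μ : Measure (Icc (-A) A)).map Subtype.val)
        ((μ : Measure (Icc (-A) A)).map Subtype.val) := by
  have hprob : ∀ μ : ProbabilityMeasure (Icc (-A) A),
      IsProbabilityMeasure ((μ : Measure (Icc (-A) A)).map Subtype.val) := fun μ =>
    Measure.isProbabilityMeasure_map measurable_subtype_coe.aemeasurable
  refine continuous_of_dominated
    (bound := fun t => exp ((A + A) * |t| + (c * A ^ 2 / 2 + c * A ^ 2 / 2)))
    (fun μ => ?_) (fun μ => ae_of_all _ ?_) (integrable_exp_mul_abs c _ _)
    (ae_of_all _ fun t => ?_)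
  · have := hprob μ
    exact ((measurable_outDens c _).mul (measurable_outDens c _).log).aestronglyMeasurable
  · have := hprob μ
    exact abs_outDens_mul_log_le c (map_val_compl_Icc _) (map_val_compl_Icc _)
  · exact continuous_mul_log.comp (continuous_integral_map_val (f := fun x => gker c x t)
      ((continuous_gker c).comp (by fun_prop : Continuous fun x : ℝ => (x, t))))

lemma continuous_gaussRate (c₁ c₂ : ℝ≥0) :
    Continuous fun μ : ProbabilityMeasure (Icc (-A) A) =>
      gaussRate c₁ c₂ ((μ : Measure (Icc (-A) A)).map Subtype.val) := by
  have hsq := continuous_integral_map_val (A := A) (continuous_pow (M := ℝ) 2)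
  exact ((hsq.const_mul _).sub (continuous_crossEnt_self c₁)).sub
    ((hsq.const_mul _).sub (continuous_crossEnt_self c₂))

lemma exists_isMax_gaussRate (c₁ c₂ : ℝ≥0) (hA : 0 ≤ A) :
    ∃ μ : Measure ℝ, IsProbabilityMeasure μ ∧ μ (Icc (-A) A)ᶜ = 0 ∧
      ∀ ν : Measure ℝ, IsProbabilityMeasure ν → ν (Icc (-A) A)ᶜ = 0 →
        gaussRate c₁ c₂ ν ≤ gaussRate c₁ c₂ μ := by
  have : Nonempty (ProbabilityMeasure (Icc (-A) A)) :=
    ⟨⟨Measure.dirac ⟨0, by simpa using hA⟩, inferInstance⟩⟩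
  obtain ⟨μ, -, hμ⟩ := isCompact_univ.exists_isMaxOn univ_nonempty
    (continuous_gaussRate (A := A) c₁ c₂).continuousOn
  refine ⟨(μ : Measure (Icc (-A) A)).map Subtype.val,
    Measure.isProbabilityMeasure_map measurable_subtype_coe.aemeasurable,
    map_val_compl_Icc _, fun ν hν hνA => ?_⟩
  have hae : ∀ᵐ x ∂ν, x ∈ Icc (-A) A := hνA
  have hmap : (ν.comap ((↑) : Icc (-A) A → ℝ)).map Subtype.val = ν := by
    rw [map_comap_subtype_coe measurableSet_Icc, Measure.restrict_eq_self_of_ae_mem hae]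
  have hp : IsProbabilityMeasure (ν.comap ((↑) : Icc (-A) A → ℝ)) := by
    constructor
    rw [← preimage_univ (f := ((↑) : Icc (-A) A → ℝ)),
      ← Measure.map_apply measurable_subtype_coe MeasurableSet.univ, hmap, measure_univ]
  have hle : gaussRate c₁ c₂ ((ν.comap ((↑) : Icc (-A) A → ℝ)).map Subtype.val) ≤
      gaussRate c₁ c₂ ((μ : Measure (Icc (-A) A)).map Subtype.val) :=
    hμ (mem_univ (⟨_, hp⟩ : ProbabilityMeasure (Icc (-A) A)))
  rwa [hmap] at hle

end Continuity

lemma mutualInfo_eq_gaussInfo {Ω W : Type*} [MeasurableSpace Ω] [MeasurableSpace W]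
    {P : Measure Ω} {X : Ω → ℝ} {V : Ω → W} (hX : Measurable X) (hV : Measurable V)
    {ν : Measure W} [IsProbabilityMeasure ν] {T : W → ℝ} (hT : Measurable T) {c : ℝ≥0}
    (hc : c ≠ 0) (hνT : ν.map T = gaussianReal 0 c) {A : ℝ} {μ : Measure ℝ}
    [IsProbabilityMeasure μ] (hμ : μ (Icc (-A) A)ᶜ = 0) (hPX : P.map X = μ)
    (hjoint : P.map (fun ω => (X ω, V ω)) =
      (μ.prod ν).withDensity (fun p => ENNReal.ofReal (gker c p.1 (T p.2)))) :
    mutualInfo P X V = (gaussInfo c μ : ℝ) := by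
  have hkm : Measurable fun p : ℝ × W => gker c p.1 (T p.2) :=
    (continuous_gker c).measurable.comp (by fun_prop : Measurable fun p : ℝ × W => (p.1, T p.2))
  have hom := measurable_outDens c μ
  have hPV : P.map V = ν.withDensity (fun w => ENNReal.ofReal (outDens c μ (T w))) := by
    have h1 : P.map V = (P.map (fun ω => (X ω, V ω))).map Prod.snd := by
      rw [Measure.map_map measurable_snd (hX.prodMk hV)]; rfl
    rw [h1, hjoint]
    ext s hs
    rw [Measure.map_apply measurable_snd hs, withDensity_apply _ (measurable_snd hs),
      withDensity_apply _ hs, ← lintegral_indicator (measurable_snd hs),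
      lintegral_prod_symm _ (by
        exact (hkm.ennreal_ofReal.indicator (measurable_snd hs)).aemeasurable),
      ← lintegral_indicator hs]
    congr 1
    ext w
    by_cases hw : w ∈ s
    · simp only [indicator, mem_preimage, hw, if_true]
      rw [outDens, ofReal_integral_eq_lintegral_ofReal (integrable_gker_left c hμ _)
        (ae_of_all _ fun x => (gker_pos c x _).le)]
    · simp [indicator, hw]
  set Q := μ.prod (ν.withDensity (fun w => ENNReal.ofReal (outDens c μ (T w)))) with hQ
  have : IsProbabilityMeasure (ν.withDensity (fun w => ENNReal.ofReal (outDens c μ (T w)))) := by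
    constructor
    rw [withDensity_apply _ MeasurableSet.univ, setLIntegral_univ,
      ← lintegral_map (f := fun t => ENNReal.ofReal (outDens c μ t)) hom.ennreal_ofReal hT, hνT,
      ← ofReal_integral_eq_lintegral_ofReal (integrable_outDens c hμ)
        (ae_of_all _ fun t => (outDens_pos c hμ t).le), integral_outDens hc hμ]
    simp
  set L : ℝ × W → ℝ := fun p => gker c p.1 (T p.2) / outDens c μ (T p.2) with hL
  have hLm : Measurable L := hkm.div (hom.comp (hT.comp measurable_snd))
  have hLpos : ∀ p, 0 < L p := fun p => div_pos (gker_pos _ _ _) (outDens_pos c hμ _)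
  have hjQ : P.map (fun ω => (X ω, V ω)) = Q.withDensity (fun p => ENNReal.ofReal (L p)) := by
    rw [hjoint, hQ, prod_withDensity_right (by fun_prop),
      ← withDensity_mul _ (by fun_prop) hLm.ennreal_ofReal]
    congr 1
    ext p
    rw [Pi.mul_apply, ← ENNReal.ofReal_mul (outDens_pos c hμ _).le, hL,
      mul_div_cancel₀ _ (outDens_pos c hμ _).ne']
  have hac : P.map (fun ω => (X ω, V ω)) ≪ Q := by
    rw [hjQ]; exact withDensity_absolutelyContinuous _ _
  have hllr : llr (P.map (fun ω => (X ω, V ω))) Q =ᵐ[P.map (fun ω => (X ω, V ω))]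
      fun p => log (L p) := by
    refine hac.ae_le ?_
    rw [hjQ]
    filter_upwards [Measure.rnDeriv_withDensity Q hLm.ennreal_ofReal] with p hp
    rw [llr, hp, ENNReal.toReal_ofReal (hLpos p).le]
  have hmapT : (μ.prod ν).map (Prod.map id T) = μ.prod (gaussianReal 0 c) := by
    rw [← Measure.map_prod_map _ _ measurable_id hT, hνT, Measure.map_id]
  have hTm : Measurable (Prod.map id T : ℝ × W → ℝ × ℝ) := measurable_id.prodMap hT
  set F : ℝ × ℝ → ℝ := fun q =>
    gker c q.1 q.2 * (q.1 * q.2 - c * q.1 ^ 2 / 2) -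
      gker c q.1 q.2 * log (outDens c μ q.2) with hF
  have hi1 : Integrable (fun q : ℝ × ℝ => gker c q.1 q.2 * (q.1 * q.2 - c * q.1 ^ 2 / 2))
      (μ.prod (gaussianReal 0 c)) := by
    refine ((integrable_exp_mul_abs c (A + A) (c * A ^ 2 / 2 + c * A ^ 2 / 2)).comp_snd μ).mono'
      ((continuous_gker c).mul (by fun_prop)).aestronglyMeasurable ?_
    filter_upwards [Measure.quasiMeasurePreserving_fst.ae (ae_abs_le hμ)] with p hp
    exact abs_mul_le_exp (by rw [abs_of_pos (gker_pos c _ _)]; exact gker_le c hp _)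
      (abs_log_gker_le c hp _)
  have hi2 := integrable_prod_gker_mul_log c hμ hμ
  have hFi : Integrable F (μ.prod (gaussianReal 0 c)) := hi1.sub hi2
  have hFT : ∀ p : ℝ × W, (ENNReal.ofReal (gker c p.1 (T p.2))).toReal • log (L p) =
      F (Prod.map id T p) := fun p => by
    rw [ENNReal.toReal_ofReal (gker_pos _ _ _).le, hL, smul_eq_mul,
      log_div (gker_pos _ _ _).ne' (outDens_pos c hμ _).ne', mul_sub, hF]
    simp only [Prod.map_fst, Prod.map_snd, id]
    congr 2
    rw [gker, log_exp]
  have hint : Integrable (fun p => log (L p)) (P.map (fun ω => (X ω, V ω))) := by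
    rw [hjoint, integrable_withDensity_iff_integrable_smul' hkm.ennreal_ofReal (by simp)]
    simp_rw [hFT]
    rw [← hmapT] at hFi
    exact hFi.comp_measurable hTm
  have hval : ∫ p, log (L p) ∂(P.map (fun ω => (X ω, V ω))) = gaussInfo c μ := by
    rw [hjoint, integral_withDensity_eq_integral_toReal_smul hkm.ennreal_ofReal (by simp)]
    simp_rw [hFT]
    rw [← integral_map hTm.aemeasurable (hmapT ▸ hFi.aestronglyMeasurable), hmapT, hF,
      integral_sub hi1 hi2, integral_prod _ hi1, integral_prod _ hi2, gaussInfo,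
      crossEnt_eq_integral_logMean c hμ hμ, ← integral_const_mul]
    congr 2
    ext x
    have hgi : Integrable (fun t => gker c x t * t) (gaussianReal 0 c) := by
      refine integrable_of_abs_le_exp ((measurable_gker_right c x).mul measurable_id)
        (|x| + 1) (c * |x| ^ 2 / 2 + 0) fun t => ?_
      exact abs_mul_le_exp (by rw [abs_of_pos (gker_pos c _ _)]; exact gker_le c le_rfl _)
        (by simp)
    have e : (fun t => gker c x t * (x * t - c * x ^ 2 / 2)) = fun t =>
        x * (gker c x t * t) - c * x ^ 2 / 2 * gker c x t := by ext t; ring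
    simp only [e]
    rw [integral_sub (hgi.const_mul x) ((integrable_gker c x).const_mul _), integral_const_mul,
      integral_const_mul, integral_gker_mul_id hc, integral_gker hc]
    ring
  rw [mutualInfo, hPX, hPV, klDiv, if_pos ⟨hac, (integrable_congr hllr).2 hint⟩,
    integral_congr_ae hllr, hval]

lemma lintegral_add_gaussianReal {v : ℝ≥0} (hv : v ≠ 0) (x : ℝ) {f : ℝ → ℝ≥0∞}
    (hf : Measurable f) :
    ∫⁻ n, f (x + n) ∂gaussianReal 0 v =
      ∫⁻ t, ENNReal.ofReal (gker v (x / v) t) * f t ∂gaussianReal 0 v := by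
  have h : (gaussianReal 0 v).map (x + ·) = gaussianReal x v := by
    rw [gaussianReal_map_const_add, zero_add]
  rw [← lintegral_map (f := f) hf (by fun_prop), h, gaussianReal_eq_withDensity hv,
    lintegral_withDensity_eq_lintegral_mul _ (measurable_gker_right _ _).ennreal_ofReal hf]
  rfl

lemma gker_div_eq {v : ℝ≥0} (hv : v ≠ 0) (x t : ℝ) :
    gker v (x / v) t = gker v⁻¹ x (t / v) := by
  have hv' : (v : ℝ) ≠ 0 := by exact_mod_cast hv
  unfold gker
  congr 1
  push_cast
  field_simp

lemma gker_mul_gker (c d : ℝ≥0) (x s t : ℝ) :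
    gker c x s * gker d x t = gker (c + d) x (s + t) := by
  unfold gker
  rw [← exp_add]
  congr 1
  push_cast
  ring

lemma gaussianReal_map_div_self {v : ℝ≥0} (hv : v ≠ 0) :
    (gaussianReal 0 v).map (· / (v : ℝ)) = gaussianReal 0 v⁻¹ := by
  have hv' : (v : ℝ) ≠ 0 := by exact_mod_cast hv
  rw [gaussianReal_map_div_const, zero_div]
  congr 1
  ext
  push_cast
  field_simp

lemma map_Xc_chan (σD σE : ℝ) (μ : Measure ℝ) : (chan μ σD σE).map Xc = μ := by
  rw [chan]
  exact measurePreserving_fst.map_eq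

section Channel

variable {σD σE A : ℝ} {μ : Measure ℝ} [IsProbabilityMeasure μ]

lemma mutualInfo_Xc_Zc (hσE : 0 < σE) (hμ : μ (Icc (-A) A)ᶜ = 0) :
    mutualInfo (chan μ σD σE) Xc Zc = (gaussInfo ((σE ^ 2).toNNReal)⁻¹ μ : ℝ) := by
  have hv : (σE ^ 2).toNNReal ≠ 0 := by simp [hσE.ne']
  have hX : Measurable Xc := by unfold Xc; fun_prop
  have hZ : Measurable Zc := by unfold Zc; fun_prop
  refine mutualInfo_eq_gaussInfo hX hZ (T := (· / ((σE ^ 2).toNNReal : ℝ))) (by fun_prop)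
    (inv_ne_zero hv) (gaussianReal_map_div_self hv) hμ (map_Xc_chan _ _ _) ?_
  refine Measure.ext_of_lintegral _ fun f hf => ?_
  have hk : Measurable fun p : ℝ × ℝ => ENNReal.ofReal
      (gker ((σE ^ 2).toNNReal)⁻¹ p.1 (p.2 / ((σE ^ 2).toNNReal : ℝ))) :=
    ((continuous_gker _).measurable.comp
      (by fun_prop : Measurable fun p : ℝ × ℝ => (p.1, p.2 / _))).ennreal_ofReal
  rw [lintegral_map hf (hX.prodMk hZ), lintegral_withDensity_eq_lintegral_mul _ hk hf,
    lintegral_prod _ (hk.mul hf).aemeasurable, chan]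
  unfold Xc Zc
  rw [lintegral_prod _ (by fun_prop)]
  congr 1
  ext x
  rw [lintegral_prod _ (by fun_prop)]
  simp only [lintegral_const, measure_univ, mul_one]
  rw [lintegral_add_gaussianReal hv x (f := fun z => f (x, z)) (by fun_prop)]
  simp only [gker_div_eq hv]
  rfl

lemma mutualInfo_Xc_YZ (hσD : 0 < σD) (hσE : 0 < σE) (hμ : μ (Icc (-A) A)ᶜ = 0) :
    mutualInfo (chan μ σD σE) Xc (fun ω => (Yc ω, Zc ω)) =
      (gaussInfo (((σD ^ 2).toNNReal)⁻¹ + ((σE ^ 2).toNNReal)⁻¹) μ : ℝ) := by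
  have hv : (σD ^ 2).toNNReal ≠ 0 := by simp [hσD.ne']
  have hw : (σE ^ 2).toNNReal ≠ 0 := by simp [hσE.ne']
  set v := (σD ^ 2).toNNReal with hvdef
  set w := (σE ^ 2).toNNReal with hwdef
  have hX : Measurable Xc := by unfold Xc; fun_prop
  have hYZ : Measurable fun ω => (Yc ω, Zc ω) := by unfold Yc Zc; fun_prop
  have hT : Measurable fun p : ℝ × ℝ => p.1 / (v : ℝ) + p.2 / (w : ℝ) := by fun_prop
  have hmap : ((gaussianReal 0 v).prod (gaussianReal 0 w)).map
      (fun p : ℝ × ℝ => p.1 / (v : ℝ) + p.2 / (w : ℝ)) = gaussianReal 0 (v⁻¹ + w⁻¹) := by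
    have h := gaussianReal_conv_gaussianReal (m₁ := 0) (m₂ := 0) (v₁ := v⁻¹) (v₂ := w⁻¹)
    rw [add_zero, ← gaussianReal_map_div_self hv, ← gaussianReal_map_div_self hw, Measure.conv,
      Measure.map_prod_map _ _ (by fun_prop) (by fun_prop),
      Measure.map_map (by fun_prop) (by fun_prop)] at h
    exact h
  refine mutualInfo_eq_gaussInfo hX hYZ hT (by simp [hv]) hmap hμ (map_Xc_chan _ _ _) ?_
  refine Measure.ext_of_lintegral _ fun f hf => ?_
  have hk : Measurable fun p : ℝ × (ℝ × ℝ) => ENNReal.ofReal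
      (gker (v⁻¹ + w⁻¹) p.1 (p.2.1 / (v : ℝ) + p.2.2 / (w : ℝ))) :=
    ((continuous_gker _).measurable.comp (by fun_prop : Measurable fun p : ℝ × (ℝ × ℝ) =>
      (p.1, p.2.1 / (v : ℝ) + p.2.2 / (w : ℝ)))).ennreal_ofReal
  rw [lintegral_map hf (hX.prodMk hYZ), lintegral_withDensity_eq_lintegral_mul _ hk hf,
    lintegral_prod _ (hk.mul hf).aemeasurable, chan]
  unfold Xc Yc Zc
  rw [lintegral_prod _ (by fun_prop)]
  congr 1
  ext x
  have hkx : Measurable fun q : ℝ × ℝ => ENNReal.ofReal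
      (gker (v⁻¹ + w⁻¹) x (q.1 / (v : ℝ) + q.2 / (w : ℝ))) * f (x, q) :=
    (hk.mul hf).comp measurable_prodMk_left
  simp only [Pi.mul_apply]
  rw [lintegral_prod _ (by fun_prop), lintegral_prod _ hkx.aemeasurable]
  have hinner : ∀ y, ∫⁻ n, f (x, y, x + n) ∂gaussianReal 0 w =
      ∫⁻ t, ENNReal.ofReal (gker w (x / w) t) * f (x, y, t) ∂gaussianReal 0 w := fun y =>
    lintegral_add_gaussianReal hw x (f := fun z => f (x, y, z)) (by fun_prop)
  have hm : Measurable fun y => ∫⁻ t, ENNReal.ofReal (gker w (x / w) t) * f (x, y, t)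
      ∂gaussianReal 0 w :=
    Measurable.lintegral_prod_right' (f := fun p : ℝ × ℝ =>
      ENNReal.ofReal (gker w (x / w) p.2) * f (x, p.1, p.2))
      (((measurable_gker_right w _).comp measurable_snd).ennreal_ofReal.mul (by fun_prop))
  simp only [← hvdef, ← hwdef, hinner]
  rw [lintegral_add_gaussianReal hv x hm]
  congr 1
  ext y
  rw [← lintegral_const_mul' _ _ ENNReal.ofReal_ne_top]
  congr 1
  ext z
  rw [← mul_assoc, ← ENNReal.ofReal_mul (gker_pos _ _ _).le, gker_div_eq hv, gker_div_eq hw,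
    gker_mul_gker]

lemma skRate_eq_gaussRate (hσD : 0 < σD) (hσE : 0 < σE) (hμ : μ (Icc (-A) A)ᶜ = 0) :
    skRate σD σE μ = (gaussRate (((σD ^ 2).toNNReal)⁻¹ + ((σE ^ 2).toNNReal)⁻¹)
      ((σE ^ 2).toNNReal)⁻¹ μ : ℝ) := by
  rw [skRate, mutualInfo_Xc_YZ hσD hσE hμ, mutualInfo_Xc_Zc hσE hμ, ← EReal.coe_sub, gaussRate]

end Channel

/-- The supremum defining the secret-key capacity is attained, and every maximizing input
distribution is discrete with finite support contained in `[−A, A]`. -/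
theorem stmt0 (σD σE A : ℝ) (hσD : 0 < σD) (hσE : 0 < σE) (hA : 0 < A) :
    (∃ μ₀ : Measure ℝ, IsProbabilityMeasure μ₀ ∧ μ₀ (Set.Icc (-A) A)ᶜ = 0 ∧
      skRate σD σE μ₀ = Ck σD σE A) ∧
    ∀ μ₀ : Measure ℝ, IsProbabilityMeasure μ₀ → μ₀ (Set.Icc (-A) A)ᶜ = 0 →
      skRate σD σE μ₀ = Ck σD σE A →
      ∃ S : Finset ℝ, (S : Set ℝ) ⊆ Set.Icc (-A) A ∧ μ₀ ((S : Set ℝ))ᶜ = 0 := by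
  have hv : (σD ^ 2).toNNReal ≠ 0 := by simp [hσD.ne']
  have hw : (σE ^ 2).toNNReal ≠ 0 := by simp [hσE.ne']
  set c₂ := ((σE ^ 2).toNNReal)⁻¹
  set c₁ := ((σD ^ 2).toNNReal)⁻¹ + c₂
  have h₂ : c₂ ≠ 0 := inv_ne_zero hw
  have hlt : c₂ < c₁ := lt_add_of_pos_left _ (by positivity)
  have h₁ : c₁ ≠ 0 := (h₂.bot_lt.trans hlt).ne'
  have hrate : ∀ ν : Measure ℝ, IsProbabilityMeasure ν → ν (Icc (-A) A)ᶜ = 0 →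
      skRate σD σE ν = (gaussRate c₁ c₂ ν : ℝ) := fun ν _ hν =>
    skRate_eq_gaussRate hσD hσE hν
  constructor
  · obtain ⟨μ, hp, hμ, hmax⟩ := exists_isMax_gaussRate c₁ c₂ hA.le
    refine ⟨μ, hp, hμ, le_antisymm (le_sSup ⟨μ, hp, hμ, rfl⟩) (sSup_le ?_)⟩
    rintro _ ⟨ν, hν, hνA, rfl⟩
    rw [hrate ν hν hνA, hrate μ hp hμ]
    exact EReal.coe_le_coe_iff.2 (hmax ν hν hνA)
  · intro μ hp hμ heq
    refine exists_finset_of_isMax h₁ h₂ hlt hA.le hμ fun ν hν hνA => ?_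
    rw [← EReal.coe_le_coe_iff, ← hrate ν hν hνA, ← hrate μ hp hμ, heq]
    exact le_sSup ⟨ν, hν, hνA, rfl⟩

end
end

section
/- Let σ_D, σ_E > 0 and A > 0. The secret-key capacity with amplitude constraint A satisfies C_k(A) ≤ (1/2) ln( 1 + A² σ_E² / ((A² + σ_E²) σ_D²) ). -/
open MeasureTheory ProbabilityTheory Real Filter Set
open scoped Classical

noncomputable section

lemma klDiv_eq_coe_klDiv {α : Type*} [MeasurableSpace α] (μ ν : Measure α)
    [IsProbabilityMeasure μ] [IsProbabilityMeasure ν] :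
    klDiv μ ν = (InformationTheory.klDiv μ ν : EReal) := by
  unfold klDiv
  split_ifs with h
  · have h0 := InformationTheory.integral_llr_add_sub_measure_univ_nonneg h.1 h.2
    rw [InformationTheory.klDiv_of_ac_of_integrable h.1 h.2, EReal.coe_ennreal_ofReal, max_eq_left h0]
    simp
  · rw [InformationTheory.klDiv_def, if_neg h]
    rfl

/-- Replacing the law of `W` by any other probability measure `ν` in the product of the marginals
can only increase the divergence defining `I(U;W)`. -/
lemma klDiv_map_prod_le {Ω α β : Type*} [MeasurableSpace Ω] [MeasurableSpace α]
    [StandardBorelSpace α] [Nonempty α] [MeasurableSpace β] (P : Measure Ω)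
    [IsProbabilityMeasure P] {U : Ω → α} {W : Ω → β} (hU : Measurable U) (hW : Measurable W)
    (ν : Measure β) [IsProbabilityMeasure ν] :
    InformationTheory.klDiv (P.map (fun ω => (U ω, W ω))) ((P.map U).prod (P.map W)) ≤
      InformationTheory.klDiv (P.map (fun ω => (W ω, U ω))) (ν.prod (P.map U)) := by
  have := Measure.isProbabilityMeasure_map (μ := P) hU.aemeasurable
  have := Measure.isProbabilityMeasure_map (μ := P) hW.aemeasurable
  have hd := compProd_map_condDistrib (μ := P) (X := W) (Y := U) (mβ := ‹_›) hU.aemeasurable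
  calc InformationTheory.klDiv (P.map (fun ω => (U ω, W ω))) ((P.map U).prod (P.map W))
      = InformationTheory.klDiv ((P.map (fun ω => (W ω, U ω))).map Prod.swap)
          (((P.map W).prod (P.map U)).map Prod.swap) := by
        rw [Measure.prod_swap, Measure.map_map measurable_swap (hW.prodMk hU)]
        rfl
    _ ≤ InformationTheory.klDiv (P.map (fun ω => (W ω, U ω))) ((P.map W).prod (P.map U)) :=
        InformationTheory.klDiv_map_le _ _ measurable_swap
    _ ≤ InformationTheory.klDiv (P.map (fun ω => (W ω, U ω))) (ν.prod (P.map U)) := by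
        rw [← hd, ← Measure.compProd_const, ← Measure.compProd_const,
          InformationTheory.klDiv_compProd_eq_add _ ν]
        exact le_add_self

/-- The kernel sending `a` to the Gaussian law of mean `m a` and variance `v`. -/
def gaussianKernel {α : Type*} [MeasurableSpace α] (m : α → ℝ) (hm : Measurable m) (v : NNReal) :
    Kernel α ℝ where
  toFun a := gaussianReal (m a) v
  measurable' := measurable_gaussianReal.comp (hm.prodMk measurable_const)

instance {α : Type*} [MeasurableSpace α] (m : α → ℝ) (hm : Measurable m) (v : NNReal) :
    IsMarkovKernel (gaussianKernel m hm v) :=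
  ⟨fun a => inferInstanceAs (IsProbabilityMeasure (gaussianReal (m a) v))⟩

lemma gaussianReal_eq_withDensity_div (m₁ m₂ : ℝ) {v₁ v₂ : NNReal} (h₁ : v₁ ≠ 0) (h₂ : v₂ ≠ 0) :
    gaussianReal m₁ v₁ =
      (gaussianReal m₂ v₂).withDensity (fun y => gaussianPDF m₁ v₁ y / gaussianPDF m₂ v₂ y) := by
  rw [gaussianReal_of_var_ne_zero _ h₁, gaussianReal_of_var_ne_zero _ h₂,
    ← withDensity_mul _ (measurable_gaussianPDF _ _)
      (g := fun y => gaussianPDF m₁ v₁ y / gaussianPDF m₂ v₂ y) (by fun_prop)]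
  congr 1
  ext y
  exact (ENNReal.mul_div_cancel (gaussianPDF_pos _ h₂ y).ne' gaussianPDF_ne_top).symm

lemma compProd_gaussianKernel_eq_withDensity {α : Type*} [MeasurableSpace α] (M : Measure α)
    [IsProbabilityMeasure M] {m₁ m₂ : α → ℝ} (hm₁ : Measurable m₁) (hm₂ : Measurable m₂)
    {v₁ v₂ : NNReal} (h₁ : v₁ ≠ 0) (h₂ : v₂ ≠ 0) :
    M ⊗ₘ gaussianKernel m₁ hm₁ v₁ = (M ⊗ₘ gaussianKernel m₂ hm₂ v₂).withDensity
      (fun p => gaussianPDF (m₁ p.1) v₁ p.2 / gaussianPDF (m₂ p.1) v₂ p.2) := by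
  have hf : Measurable (fun p : α × ℝ =>
      gaussianPDF (m₁ p.1) v₁ p.2 / gaussianPDF (m₂ p.1) v₂ p.2) := by fun_prop
  ext s hs
  rw [withDensity_apply _ hs, ← lintegral_indicator hs,
    Measure.lintegral_compProd (hf.indicator hs), Measure.compProd_apply hs]
  refine lintegral_congr fun a => ?_
  change gaussianReal (m₁ a) v₁ _ = ∫⁻ b, _ ∂(gaussianReal (m₂ a) v₂)
  rw [gaussianReal_eq_withDensity_div (m₁ a) (m₂ a) h₁ h₂,
    withDensity_apply _ (measurable_prodMk_left hs),
    ← lintegral_indicator (measurable_prodMk_left hs)]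
  rfl

lemma log_gaussianPDF_div (m₁ m₂ y : ℝ) {v₁ v₂ : NNReal} (h₁ : v₁ ≠ 0) (h₂ : v₂ ≠ 0) :
    Real.log (gaussianPDF m₁ v₁ y / gaussianPDF m₂ v₂ y).toReal =
      1 / 2 * Real.log (v₂ / v₁) - (y - m₁) ^ 2 / (2 * v₁) + (y - m₂) ^ 2 / (2 * v₂) := by
  have p₁ : (0 : ℝ) < v₁ := by positivity
  have p₂ : (0 : ℝ) < v₂ := by positivity
  rw [ENNReal.toReal_div, toReal_gaussianPDF, toReal_gaussianPDF,
    Real.log_div (gaussianPDFReal_pos _ _ _ h₁).ne' (gaussianPDFReal_pos _ _ _ h₂).ne',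
    gaussianPDFReal_def, gaussianPDFReal_def]
  simp only
  rw [Real.log_mul (by positivity) (Real.exp_ne_zero _),
    Real.log_mul (by positivity) (Real.exp_ne_zero _), Real.log_inv, Real.log_inv, Real.log_exp,
    Real.log_exp, Real.log_sqrt (by positivity), Real.log_sqrt (by positivity),
    Real.log_mul (by positivity) p₁.ne', Real.log_mul (by positivity) p₂.ne',
    Real.log_div p₂.ne' p₁.ne']
  ring

lemma llr_compProd_gaussianKernel {α : Type*} [MeasurableSpace α] (M : Measure α)
    [IsProbabilityMeasure M] {m₁ m₂ : α → ℝ} (hm₁ : Measurable m₁) (hm₂ : Measurable m₂)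
    {v₁ v₂ : NNReal} (h₁ : v₁ ≠ 0) (h₂ : v₂ ≠ 0) :
    M ⊗ₘ gaussianKernel m₁ hm₁ v₁ ≪ M ⊗ₘ gaussianKernel m₂ hm₂ v₂ ∧
    llr (M ⊗ₘ gaussianKernel m₁ hm₁ v₁) (M ⊗ₘ gaussianKernel m₂ hm₂ v₂)
      =ᵐ[M ⊗ₘ gaussianKernel m₁ hm₁ v₁] fun p => 1 / 2 * Real.log (v₂ / v₁)
        - (p.2 - m₁ p.1) ^ 2 / (2 * v₁) + (p.2 - m₂ p.1) ^ 2 / (2 * v₂) := by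
  have hf : Measurable (fun p : α × ℝ =>
      gaussianPDF (m₁ p.1) v₁ p.2 / gaussianPDF (m₂ p.1) v₂ p.2) := by fun_prop
  have hac : M ⊗ₘ gaussianKernel m₁ hm₁ v₁ ≪ M ⊗ₘ gaussianKernel m₂ hm₂ v₂ := by
    rw [compProd_gaussianKernel_eq_withDensity M hm₁ hm₂ h₁ h₂]
    exact withDensity_absolutelyContinuous _ _
  refine ⟨hac, ?_⟩
  have h := Measure.rnDeriv_withDensity (M ⊗ₘ gaussianKernel m₂ hm₂ v₂) hf
  rw [← compProd_gaussianKernel_eq_withDensity M hm₁ hm₂ h₁ h₂] at h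
  filter_upwards [hac.ae_le h] with p hp
  rw [llr, hp, log_gaussianPDF_div _ _ _ h₁ h₂]

instance (μ : Measure ℝ) [IsProbabilityMeasure μ] (σD σE : ℝ) :
    IsProbabilityMeasure (chan μ σD σE) := by
  unfold chan; infer_instance

@[fun_prop]
lemma measurable_Xc : Measurable Xc := by unfold Xc; fun_prop

@[fun_prop]
lemma measurable_Yc : Measurable Yc := by unfold Yc; fun_prop

@[fun_prop]
lemma measurable_Zc : Measurable Zc := by unfold Zc; fun_prop

/-- Given `(X,Z)`, the law of `Y` is Gaussian with mean `X` and variance `σD²`. -/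
lemma map_chan_eq_compProd (μ : Measure ℝ) [IsProbabilityMeasure μ] (σD σE : ℝ) :
    (chan μ σD σE).map (fun ω => ((Xc ω, Zc ω), Yc ω)) =
      (chan μ σD σE).map (fun ω => (Xc ω, Zc ω)) ⊗ₘ
        gaussianKernel Prod.fst measurable_fst (σD ^ 2).toNNReal := by
  ext s hs
  have hind : Measurable (s.indicator (1 : (ℝ × ℝ) × ℝ → ENNReal)) :=
    measurable_one.indicator hs
  have hK := hind.lintegral_kernel_prod_right'
    (κ := gaussianKernel (α := ℝ × ℝ) Prod.fst measurable_fst (σD ^ 2).toNNReal)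
  have hK' : Measurable fun ω => ∫⁻ y, s.indicator (1 : (ℝ × ℝ) × ℝ → ENNReal) ((Xc ω, Zc ω), y)
      ∂(gaussianKernel Prod.fst measurable_fst (σD ^ 2).toNNReal (Xc ω, Zc ω)) :=
    hK.comp (measurable_Xc.prodMk measurable_Zc)
  rw [← lintegral_indicator_one hs, ← lintegral_indicator_one hs,
    lintegral_map hind (by fun_prop), Measure.lintegral_compProd hind,
    lintegral_map hK (by fun_prop)]
  unfold chan
  rw [lintegral_prod _ (by fun_prop), lintegral_prod _ hK'.aemeasurable]
  refine lintegral_congr fun x => ?_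
  rw [lintegral_prod_symm' _ (by fun_prop),
    lintegral_prod_symm' (fun p : ℝ × ℝ => ∫⁻ y, s.indicator 1 ((Xc (x, p), Zc (x, p)), y)
      ∂(gaussianKernel Prod.fst measurable_fst (σD ^ 2).toNNReal (Xc (x, p), Zc (x, p))))
      (hK'.comp measurable_prodMk_left)]
  refine lintegral_congr fun e => ?_
  simp only [Xc, Yc, Zc]
  rw [lintegral_const, measure_univ, mul_one]
  change _ = ∫⁻ b, _ ∂(gaussianReal x _)
  have h := gaussianReal_map_const_add (μ := 0) (v := (σD ^ 2).toNNReal) x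
  rw [zero_add] at h
  rw [← h, lintegral_map (by fun_prop) (by fun_prop)]

/-- The second moment of `a X + b N_D + c N_E`. -/
lemma integral_sq_chan (μ : Measure ℝ) [IsProbabilityMeasure μ] (hμ : MemLp id 2 μ)
    (σD σE a b c : ℝ) :
    Integrable (fun ω => (a * ω.1 + b * ω.2.1 + c * ω.2.2) ^ 2) (chan μ σD σE) ∧
    ∫ ω, (a * ω.1 + b * ω.2.1 + c * ω.2.2) ^ 2 ∂(chan μ σD σE) =
      a ^ 2 * ∫ x, x ^ 2 ∂μ + b ^ 2 * σD ^ 2 + c ^ 2 * σE ^ 2 := by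
  have hD : MemLp id 2 (gaussianReal 0 (σD ^ 2).toNNReal) := memLp_id_gaussianReal' 2 (by simp)
  have hE : MemLp id 2 (gaussianReal 0 (σE ^ 2).toNNReal) := memLp_id_gaussianReal' 2 (by simp)
  have hsq (σ : ℝ) : ∫ x, x ^ 2 ∂(gaussianReal 0 (σ ^ 2).toNNReal) = σ ^ 2 := by
    have h := variance_of_integral_eq_zero (μ := gaussianReal 0 (σ ^ 2).toNNReal) (X := id)
      aemeasurable_id (by simp)
    rw [variance_id_gaussianReal, Real.coe_toNNReal _ (sq_nonneg σ)] at h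
    exact h.symm
  have iX : Integrable (fun x : ℝ => x) μ := hμ.integrable (by norm_num)
  have iD : Integrable (fun x : ℝ => x) (gaussianReal 0 (σD ^ 2).toNNReal) :=
    hD.integrable (by norm_num)
  have iE : Integrable (fun x : ℝ => x) (gaussianReal 0 (σE ^ 2).toNNReal) :=
    hE.integrable (by norm_num)
  have key {f g h : ℝ → ℝ} (hf : Integrable f μ)
      (hg : Integrable g (gaussianReal 0 (σD ^ 2).toNNReal))
      (hh : Integrable h (gaussianReal 0 (σE ^ 2).toNNReal)) (k : ℝ) :
      Integrable (fun ω => k * (f ω.1 * (g ω.2.1 * h ω.2.2))) (chan μ σD σE) ∧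
      ∫ ω, k * (f ω.1 * (g ω.2.1 * h ω.2.2)) ∂(chan μ σD σE) =
        k * ((∫ x, f x ∂μ) * ((∫ x, g x ∂(gaussianReal 0 (σD ^ 2).toNNReal)) *
          ∫ x, h x ∂(gaussianReal 0 (σE ^ 2).toNNReal))) := by
    refine ⟨(hf.mul_prod (hg.mul_prod hh)).const_mul k, ?_⟩
    unfold chan
    rw [integral_const_mul, integral_prod_mul (f := f) (g := fun p : ℝ × ℝ => g p.1 * h p.2),
      integral_prod_mul]
  have c1 {ν : Measure ℝ} [IsProbabilityMeasure ν] : Integrable (fun _ : ℝ => (1 : ℝ)) ν :=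
    integrable_const 1
  obtain ⟨i₁, e₁⟩ := key hμ.integrable_sq c1 c1 (a ^ 2)
  obtain ⟨i₂, e₂⟩ := key c1 hD.integrable_sq c1 (b ^ 2)
  obtain ⟨i₃, e₃⟩ := key c1 c1 hE.integrable_sq (c ^ 2)
  obtain ⟨i₄, e₄⟩ := key iX iD c1 (2 * a * b)
  obtain ⟨i₅, e₅⟩ := key iX c1 iE (2 * a * c)
  obtain ⟨i₆, e₆⟩ := key c1 iD iE (2 * b * c)
  have hI := ((((i₁.add i₂).add i₃).add i₄).add i₅).add i₆
  have hfun : (fun ω : ℝ × ℝ × ℝ => (a * ω.1 + b * ω.2.1 + c * ω.2.2) ^ 2) =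
      (fun ω => a ^ 2 * (id ω.1 ^ 2 * (1 * 1))) + (fun ω => b ^ 2 * (1 * (id ω.2.1 ^ 2 * 1)))
      + (fun ω => c ^ 2 * (1 * (1 * id ω.2.2 ^ 2))) + (fun ω => 2 * a * b * (ω.1 * (ω.2.1 * 1)))
      + (fun ω => 2 * a * c * (ω.1 * (1 * ω.2.2))) + (fun ω => 2 * b * c * (1 * (ω.2.1 * ω.2.2))) := by
    ext ω
    simp only [Pi.add_apply, id]
    ring
  rw [hfun]
  refine ⟨hI, ?_⟩
  rw [integral_add' ((((i₁.add i₂).add i₃).add i₄).add i₅) i₆,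
    integral_add' (((i₁.add i₂).add i₃).add i₄) i₅, integral_add' ((i₁.add i₂).add i₃) i₄,
    integral_add' (i₁.add i₂) i₃, integral_add' i₁ i₂, e₁, e₂, e₃, e₄, e₅, e₆]
  simp [hsq]

lemma integral_sq_le (μ : Measure ℝ) [IsProbabilityMeasure μ] {A : ℝ}
    (hμ : μ (Set.Icc (-A) A)ᶜ = 0) : MemLp id 2 μ ∧ ∫ x, x ^ 2 ∂μ ≤ A ^ 2 := by
  have h : ∀ᵐ x ∂μ, |x| ≤ A := by
    filter_upwards [mem_ae_iff.2 hμ] with x hx using abs_le.2 hx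
  have hm : MemLp id 2 μ := MemLp.of_bound (by fun_prop) A h
  refine ⟨hm, ?_⟩
  calc ∫ x, x ^ 2 ∂μ ≤ ∫ _, A ^ 2 ∂μ := by
        refine integral_mono_ae hm.integrable_sq (integrable_const _) ?_
        filter_upwards [h] with x hx using sq_le_sq' (abs_le.1 hx).1 (abs_le.1 hx).2
    _ = A ^ 2 := by simp

/-- Conditional divergence of the channel to `Y` from the Gaussian kernel with
mean `a Z` and variance `v`. -/
lemma klDiv_compProd_gaussianKernel_chan (μ : Measure ℝ) [IsProbabilityMeasure μ]
    (hμ : MemLp id 2 μ) {σD : ℝ} (hσD : 0 < σD) (σE a : ℝ) {v : NNReal} (hv : v ≠ 0) :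
    InformationTheory.klDiv
      ((chan μ σD σE).map (fun ω => (Xc ω, Zc ω)) ⊗ₘ
        gaussianKernel Prod.fst measurable_fst (σD ^ 2).toNNReal)
      ((chan μ σD σE).map (fun ω => (Xc ω, Zc ω)) ⊗ₘ
        gaussianKernel (fun p => a * p.2) (by fun_prop) v) =
    ENNReal.ofReal (1 / 2 * Real.log (v / σD ^ 2) - 1 / 2 +
      ((1 - a) ^ 2 * ∫ x, x ^ 2 ∂μ + σD ^ 2 + a ^ 2 * σE ^ 2) / (2 * v)) := by
  have : IsProbabilityMeasure ((chan μ σD σE).map (fun ω => (Xc ω, Zc ω))) :=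
    Measure.isProbabilityMeasure_map (by fun_prop)
  have hσ2 : (σD ^ 2).toNNReal ≠ 0 := by
    simpa using hσD.ne'
  obtain ⟨hac, hllr⟩ := llr_compProd_gaussianKernel
    ((chan μ σD σE).map (fun ω => (Xc ω, Zc ω))) measurable_fst
    (m₂ := fun p : ℝ × ℝ => a * p.2) (by fun_prop) hσ2 hv
  obtain ⟨i₁, e₁⟩ := integral_sq_chan μ hμ σD σE 0 1 0
  obtain ⟨i₂, e₂⟩ := integral_sq_chan μ hμ σD σE (1 - a) 1 (-a)
  have hmeas : Measurable (fun p : (ℝ × ℝ) × ℝ =>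
      1 / 2 * Real.log (v / (σD ^ 2).toNNReal) - (p.2 - p.1.1) ^ 2 / (2 * (σD ^ 2).toNNReal)
        + (p.2 - a * p.1.2) ^ 2 / (2 * v)) := by fun_prop
  have hfun : (fun ω : ℝ × ℝ × ℝ => 1 / 2 * Real.log (v / (σD ^ 2).toNNReal)
        - (Yc ω - Xc ω) ^ 2 / (2 * (σD ^ 2).toNNReal) + (Yc ω - a * Zc ω) ^ 2 / (2 * v)) =
      fun ω => 1 / 2 * Real.log (v / (σD ^ 2).toNNReal)
        - (0 * ω.1 + 1 * ω.2.1 + 0 * ω.2.2) ^ 2 / (2 * (σD ^ 2).toNNReal)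
        + ((1 - a) * ω.1 + 1 * ω.2.1 + -a * ω.2.2) ^ 2 / (2 * v) := by
    ext ω
    simp only [Xc, Yc, Zc]
    ring
  have j₁ := (integrable_const (μ := chan μ σD σE)
    (1 / 2 * Real.log (v / (σD ^ 2).toNNReal))).sub (i₁.div_const (2 * (σD ^ 2).toNNReal))
  have j₂ := i₂.div_const (2 * (v : ℝ))
  have hint : Integrable (fun p : (ℝ × ℝ) × ℝ =>
      1 / 2 * Real.log (v / (σD ^ 2).toNNReal) - (p.2 - p.1.1) ^ 2 / (2 * (σD ^ 2).toNNReal)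
        + (p.2 - a * p.1.2) ^ 2 / (2 * v)) ((chan μ σD σE).map (fun ω => (Xc ω, Zc ω)) ⊗ₘ
        gaussianKernel Prod.fst measurable_fst (σD ^ 2).toNNReal) := by
    rw [← map_chan_eq_compProd, integrable_map_measure hmeas.aestronglyMeasurable (by fun_prop)]
    change Integrable (fun ω : ℝ × ℝ × ℝ => 1 / 2 * Real.log (v / (σD ^ 2).toNNReal)
        - (Yc ω - Xc ω) ^ 2 / (2 * (σD ^ 2).toNNReal) + (Yc ω - a * Zc ω) ^ 2 / (2 * v)) _
    rw [hfun]
    exact j₁.add j₂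
  rw [InformationTheory.klDiv_of_ac_of_integrable hac ((integrable_congr hllr).2 hint),
    integral_congr_ae hllr, probReal_univ, probReal_univ, add_sub_cancel_right,
    ← map_chan_eq_compProd, integral_map (by fun_prop) hmeas.aestronglyMeasurable, hfun]
  congr 1
  have hs : (((σD ^ 2).toNNReal : NNReal) : ℝ) = σD ^ 2 := Real.coe_toNNReal _ (by positivity)
  refine (integral_add j₁ j₂).trans ?_
  simp only [Pi.sub_apply]
  rw [integral_sub (integrable_const _) (i₁.div_const _), integral_div, integral_div, e₁, e₂,
    integral_const, probReal_univ, hs]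
  field_simp
  ring

/-- `I(X;(Y,Z))` is at most `I(X;Z)` plus the conditional divergence of the channel to `Y` from the
Gaussian kernel with mean `a Z` and variance `v`. -/
lemma klDiv_map_chan_le (μ : Measure ℝ) [IsProbabilityMeasure μ] (σD σE a : ℝ) (v : NNReal) :
    InformationTheory.klDiv ((chan μ σD σE).map (fun ω => (Xc ω, (Yc ω, Zc ω))))
      (((chan μ σD σE).map Xc).prod ((chan μ σD σE).map (fun ω => (Yc ω, Zc ω)))) ≤
    InformationTheory.klDiv ((chan μ σD σE).map (fun ω => (Xc ω, Zc ω)))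
      (((chan μ σD σE).map Xc).prod ((chan μ σD σE).map Zc)) +
    InformationTheory.klDiv
      ((chan μ σD σE).map (fun ω => (Xc ω, Zc ω)) ⊗ₘ
        gaussianKernel Prod.fst measurable_fst (σD ^ 2).toNNReal)
      ((chan μ σD σE).map (fun ω => (Xc ω, Zc ω)) ⊗ₘ
        gaussianKernel (fun p => a * p.2) (by fun_prop) v) := by
  have : IsProbabilityMeasure ((chan μ σD σE).map (fun ω => (Xc ω, Zc ω))) :=
    Measure.isProbabilityMeasure_map (by fun_prop)
  have : IsProbabilityMeasure ((chan μ σD σE).map Xc) :=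
    Measure.isProbabilityMeasure_map (by fun_prop)
  have : IsProbabilityMeasure ((chan μ σD σE).map Zc) :=
    Measure.isProbabilityMeasure_map (by fun_prop)
  set PX := (chan μ σD σE).map Xc
  set PZ := (chan μ σD σE).map Zc
  set q := gaussianKernel (fun z : ℝ => a * z) (by fun_prop) v
  have : IsProbabilityMeasure ((PZ ⊗ₘ q).map Prod.swap) :=
    Measure.isProbabilityMeasure_map (by fun_prop)
  rw [← InformationTheory.klDiv_compProd_eq_add, ← map_chan_eq_compProd]
  refine (klDiv_map_prod_le (chan μ σD σE) measurable_Xc (measurable_Yc.prodMk measurable_Zc)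
    ((PZ ⊗ₘ q).map Prod.swap)).trans ?_
  have hT : Measurable (fun p : (ℝ × ℝ) × ℝ => ((p.2, p.1.2), p.1.1)) := by fun_prop
  have h := InformationTheory.klDiv_map_le
    ((chan μ σD σE).map (fun ω => ((Xc ω, Zc ω), Yc ω)))
    (PX.prod PZ ⊗ₘ gaussianKernel (fun p : ℝ × ℝ => a * p.2) (by fun_prop) v) hT
  rw [Measure.map_map hT (by fun_prop)] at h
  have hQ : (PX.prod PZ ⊗ₘ gaussianKernel (fun p : ℝ × ℝ => a * p.2) (by fun_prop) v).map
      (fun p : (ℝ × ℝ) × ℝ => ((p.2, p.1.2), p.1.1)) = ((PZ ⊗ₘ q).map Prod.swap).prod PX := by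
    ext s hs
    have hind : Measurable (s.indicator (1 : (ℝ × ℝ) × ℝ → ENNReal)) :=
      measurable_one.indicator hs
    rw [← lintegral_indicator_one hs, ← lintegral_indicator_one hs,
      lintegral_map hind hT, lintegral_prod_symm' _ hind]
    have hind' : Measurable (fun p : (ℝ × ℝ) × ℝ =>
        s.indicator (1 : (ℝ × ℝ) × ℝ → ENNReal) ((p.2, p.1.2), p.1.1)) := hind.comp hT
    rw [Measure.lintegral_compProd hind',
      lintegral_prod _ hind'.lintegral_kernel_prod_right'.aemeasurable]
    refine lintegral_congr fun x => ?_
    rw [lintegral_map (by fun_prop) measurable_swap, Measure.lintegral_compProd (by fun_prop)]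
    rfl
  rwa [hQ] at h

/-- Upper bound: the secret-key capacity with amplitude constraint `A` is at most the
secret-key capacity with an average power constraint `A²`. -/
theorem stmt4 (σD σE A : ℝ) (hσD : 0 < σD) (hσE : 0 < σE) (hA : 0 < A) :
    Ck σD σE A ≤
      ((1 / 2 * Real.log (1 + A ^ 2 * σE ^ 2 / ((A ^ 2 + σE ^ 2) * σD ^ 2)) : ℝ) : EReal) := by
  refine sSup_le ?_
  rintro r ⟨μ, hμ, hsupp, rfl⟩
  obtain ⟨hm, hle⟩ := integral_sq_le μ hsupp
  have : IsProbabilityMeasure ((chan μ σD σE).map (fun ω => (Xc ω, Zc ω))) :=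
    Measure.isProbabilityMeasure_map (by fun_prop)
  have : IsProbabilityMeasure ((chan μ σD σE).map (fun ω => (Yc ω, Zc ω))) :=
    Measure.isProbabilityMeasure_map (by fun_prop)
  have : IsProbabilityMeasure ((chan μ σD σE).map (fun ω => (Xc ω, (Yc ω, Zc ω)))) :=
    Measure.isProbabilityMeasure_map (by fun_prop)
  have : IsProbabilityMeasure ((chan μ σD σE).map Xc) :=
    Measure.isProbabilityMeasure_map (by fun_prop)
  have : IsProbabilityMeasure ((chan μ σD σE).map Zc) :=
    Measure.isProbabilityMeasure_map (by fun_prop)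
  set a := A ^ 2 / (A ^ 2 + σE ^ 2) with ha
  set w := σD ^ 2 + A ^ 2 * σE ^ 2 / (A ^ 2 + σE ^ 2) with hw
  have hw0 : 0 < w := by positivity
  have hv : w.toNNReal ≠ 0 := by simpa using hw0
  have hwc : (w.toNNReal : ℝ) = w := Real.coe_toNNReal _ hw0.le
  have hcap : 0 ≤ 1 / 2 * Real.log (1 + A ^ 2 * σE ^ 2 / ((A ^ 2 + σE ^ 2) * σD ^ 2)) := by
    have : 0 ≤ Real.log (1 + A ^ 2 * σE ^ 2 / ((A ^ 2 + σE ^ 2) * σD ^ 2)) :=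
      Real.log_nonneg (le_add_of_nonneg_right (by positivity))
    positivity
  have hlog : w / σD ^ 2 = 1 + A ^ 2 * σE ^ 2 / ((A ^ 2 + σE ^ 2) * σD ^ 2) := by
    rw [hw]
    field_simp
  have hvar : (1 - a) ^ 2 * A ^ 2 + σD ^ 2 + a ^ 2 * σE ^ 2 = w := by
    rw [hw, ha]
    field_simp
    ring
  unfold skRate mutualInfo
  rw [klDiv_eq_coe_klDiv, klDiv_eq_coe_klDiv]
  refine EReal.sub_le_of_le_add' ?_
  have h := klDiv_map_chan_le μ σD σE a w.toNNReal
  rw [klDiv_compProd_gaussianKernel_chan μ hm hσD σE a hv] at h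
  refine (EReal.coe_ennreal_le_coe_ennreal_iff.2 h).trans ?_
  rw [EReal.coe_ennreal_add, EReal.coe_ennreal_ofReal]
  refine add_le_add le_rfl (EReal.coe_le_coe_iff.2 (max_le ?_ hcap))
  rw [hwc, hlog]
  have hmom : ((1 - a) ^ 2 * ∫ x, x ^ 2 ∂μ + σD ^ 2 + a ^ 2 * σE ^ 2) / (2 * w) ≤ 1 / 2 := by
    rw [div_le_iff₀ (by positivity)]
    have := mul_le_mul_of_nonneg_left hle (sq_nonneg (1 - a))
    linarith
  linarith

end
end

section
/- Let σ_D, σ_E > 0 and let σ_DE² = 1/(1/σ_D² + 1/σ_E²). For every A > 0, the secret-key capacity with amplitude constraint A satisfies C_k(A) ≥ C(A, σ_DE) − C(A, σ_E), where C(A, σ) denotes the capacity of the amplitude-constrained Gaussian channel with noise standard deviation σ. -/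
open MeasureTheory ProbabilityTheory Real Filter Set
open scoped Classical

noncomputable section

/-- Capacity of the amplitude-constrained Gaussian channel with amplitude constraint `A`
and noise standard deviation `σ`. -/
def gaussCap (A σ : ℝ) : EReal :=
  sSup {r : EReal | ∃ μ : Measure ℝ, IsProbabilityMeasure μ ∧ μ (Set.Icc (-A) A)ᶜ = 0 ∧
    r = mutualInfo (μ.prod (gaussianReal 0 (σ ^ 2).toNNReal))
      (fun ω => ω.1) (fun ω => ω.1 + ω.2)}

lemma klDiv_eq_coe {α : Type*} [MeasurableSpace α] (μ ν : Measure α)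
    [IsProbabilityMeasure μ] [IsProbabilityMeasure ν] :
    klDiv μ ν = ((InformationTheory.klDiv μ ν : ENNReal) : EReal) := by
  unfold klDiv
  split_ifs with h
  · rw [← InformationTheory.toReal_klDiv_of_measure_eq h.1 (by simp),
      EReal.coe_ennreal_toReal (InformationTheory.klDiv_ne_top h.1 h.2)]
  · have : InformationTheory.klDiv μ ν = ⊤ :=
      InformationTheory.klDiv_eq_top_iff.2 fun h1 h2 => h ⟨h1, h2⟩
    simp [this]

lemma klDiv_ne_bot {α : Type*} [MeasurableSpace α] (μ ν : Measure α) : klDiv μ ν ≠ ⊥ := by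
  unfold klDiv
  split_ifs <;> simp

/-- Data processing: `I(U; g(V)) ≤ I(U; V)`. -/
lemma mutualInfo_comp_right_le {Ω α β γ : Type*} [MeasurableSpace Ω] [MeasurableSpace α]
    [MeasurableSpace β] [MeasurableSpace γ] (P : Measure Ω) [IsProbabilityMeasure P]
    {U : Ω → α} {V : Ω → β} {g : β → γ} (hU : Measurable U) (hV : Measurable V)
    (hg : Measurable g) : mutualInfo P U (fun ω => g (V ω)) ≤ mutualInfo P U V := by
  have hgV : Measurable fun ω => g (V ω) := hg.comp hV
  have := Measure.isProbabilityMeasure_map (μ := P) hU.aemeasurable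
  have := Measure.isProbabilityMeasure_map (μ := P) hV.aemeasurable
  have := Measure.isProbabilityMeasure_map (μ := P) hgV.aemeasurable
  have := Measure.isProbabilityMeasure_map (μ := P) (hU.prodMk hV).aemeasurable
  have := Measure.isProbabilityMeasure_map (μ := P) (hU.prodMk hgV).aemeasurable
  unfold mutualInfo
  rw [klDiv_eq_coe, klDiv_eq_coe, EReal.coe_ennreal_le_coe_ennreal_iff]
  have hG : Measurable (Prod.map (id : α → α) g) := measurable_id.prodMap hg
  have h1 : P.map (fun ω => (U ω, g (V ω))) =
      (P.map fun ω => (U ω, V ω)).map (Prod.map id g) := by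
    rw [Measure.map_map hG (hU.prodMk hV)]
    rfl
  have h2 : (P.map U).prod (P.map fun ω => g (V ω)) =
      ((P.map U).prod (P.map V)).map (Prod.map id g) := by
    rw [← Measure.map_prod_map _ _ measurable_id hg, Measure.map_id, Measure.map_map hg hV]
    rfl
  rw [h1, h2]
  exact InformationTheory.klDiv_map_le _ _ hG

lemma mutualInfo_map {Ω Ω' α β : Type*} [MeasurableSpace Ω] [MeasurableSpace Ω']
    [MeasurableSpace α] [MeasurableSpace β] (P : Measure Ω) {f : Ω → Ω'} {U : Ω' → α}
    {V : Ω' → β} (hf : Measurable f) (hU : Measurable U) (hV : Measurable V) :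
    mutualInfo (P.map f) U V = mutualInfo P (fun ω => U (f ω)) (fun ω => V (f ω)) := by
  unfold mutualInfo
  rw [Measure.map_map (hU.prodMk hV) hf, Measure.map_map hU hf, Measure.map_map hV hf]
  rfl

/-- If a measurable function `h` of the two noises has law `ν`, the mutual information between
`X` and `X + h(N_D, N_E)` is that of the additive channel with noise law `ν`. -/
lemma mutualInfo_chan_noise (μ : Measure ℝ) [IsProbabilityMeasure μ] (σD σE : ℝ)
    {h : ℝ × ℝ → ℝ} (hh : Measurable h) {ν : Measure ℝ}
    (hν : ((gaussianReal 0 (σD ^ 2).toNNReal).prod (gaussianReal 0 (σE ^ 2).toNNReal)).map h = ν) :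
    mutualInfo (chan μ σD σE) Xc (fun ω => ω.1 + h ω.2) =
      mutualInfo (μ.prod ν) (fun ω => ω.1) (fun ω => ω.1 + ω.2) := by
  have : μ.prod ν = (chan μ σD σE).map (Prod.map id h) := by
    rw [chan, ← Measure.map_prod_map _ _ measurable_id hh, Measure.map_id, hν]
  rw [this, mutualInfo_map _ (measurable_id.prodMap hh) measurable_fst (by fun_prop)]
  rfl

/-- A linear combination of two independent centred Gaussian variables is Gaussian. -/
lemma map_linearCombination_gaussianReal_prod (a b : ℝ) (v w : NNReal) :
    ((gaussianReal 0 v).prod (gaussianReal 0 w)).map (fun p : ℝ × ℝ => a * p.1 + b * p.2) =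
      gaussianReal 0 (NNReal.mk (a ^ 2) (sq_nonneg a) * v + NNReal.mk (b ^ 2) (sq_nonneg b) * w) := by
  have h : (fun p : ℝ × ℝ => a * p.1 + b * p.2) =
      (fun p : ℝ × ℝ => p.1 + p.2) ∘ Prod.map (a * ·) (b * ·) := rfl
  rw [h, ← Measure.map_map (by fun_prop)
    ((measurable_const_mul a).prodMap (measurable_const_mul b)),
    ← Measure.map_prod_map _ _ (measurable_const_mul a) (measurable_const_mul b),
    gaussianReal_map_const_mul, gaussianReal_map_const_mul]
  have := gaussianReal_conv_gaussianReal (m₁ := a * 0) (m₂ := b * 0)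
    (v₁ := NNReal.mk (a ^ 2) (sq_nonneg a) * v) (v₂ := NNReal.mk (b ^ 2) (sq_nonneg b) * w)
  simpa [Measure.conv] using this

/-- The minimum-variance combination of the two noises has variance `1 / (1/σD² + 1/σE²)`. -/
lemma map_combined_noise {σD σE : ℝ} (hσD : 0 < σD) (hσE : 0 < σE) :
    ((gaussianReal 0 (σD ^ 2).toNNReal).prod (gaussianReal 0 (σE ^ 2).toNNReal)).map
      (fun p : ℝ × ℝ => σE ^ 2 / (σD ^ 2 + σE ^ 2) * p.1 + σD ^ 2 / (σD ^ 2 + σE ^ 2) * p.2) =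
    gaussianReal 0 (Real.sqrt (1 / (1 / σD ^ 2 + 1 / σE ^ 2)) ^ 2).toNNReal := by
  rw [map_linearCombination_gaussianReal_prod, Real.sq_sqrt (by positivity)]
  congr 1
  ext
  rw [Real.coe_toNNReal _ (by positivity)]
  push_cast [NNReal.coe_mk]
  rw [Real.coe_toNNReal _ (by positivity), Real.coe_toNNReal _ (by positivity)]
  field_simp
  ring

/-- Lower bound: `C_k(A) ≥ C(A, σ_DE) − C(A, σ_E)` with `σ_DE² = 1/(1/σ_D² + 1/σ_E²)`. -/
theorem stmt5 (σD σE : ℝ) (hσD : 0 < σD) (hσE : 0 < σE) (A : ℝ) (hA : 0 < A) :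
    gaussCap A (Real.sqrt (1 / (1 / σD ^ 2 + 1 / σE ^ 2))) - gaussCap A σE ≤ Ck σD σE A := by
  have hbot : gaussCap A σE ≠ ⊥ := by
    refine ne_bot_of_le_ne_bot (klDiv_ne_bot _ _)
      (le_sSup ⟨Measure.dirac 0, inferInstance, ?_, rfl⟩)
    rw [Measure.dirac_apply' _ measurableSet_Icc.compl]
    simp [hA.le]
  by_cases htop : gaussCap A σE = ⊤
  · simp [htop]
  rw [EReal.sub_le_iff_le_add (.inl hbot) (.inl htop)]
  refine sSup_le ?_
  rintro _ ⟨μ, hμ, hsupp, rfl⟩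
  rw [← EReal.sub_le_iff_le_add (.inl hbot) (.inl htop)]
  refine le_trans (EReal.sub_le_sub ?_ ?_) (le_sSup ⟨μ, hμ, hsupp, rfl⟩)
  · have : IsProbabilityMeasure (chan μ σD σE) := by unfold chan; infer_instance
    have hX : Measurable Xc := measurable_fst
    have hYZ : Measurable fun ω => (Yc ω, Zc ω) := by unfold Yc Zc; fun_prop
    rw [← mutualInfo_chan_noise μ σD σE (by fun_prop) (map_combined_noise hσD hσE)]
    convert mutualInfo_comp_right_le (chan μ σD σE) hX hYZ (g := fun p : ℝ × ℝ =>
      σE ^ 2 / (σD ^ 2 + σE ^ 2) * p.1 + σD ^ 2 / (σD ^ 2 + σE ^ 2) * p.2) (by fun_prop) using 2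
    funext ω
    simp only [Yc, Zc]
    field_simp
    ring
  · refine le_sSup ⟨μ, hμ, hsupp, ?_⟩
    exact mutualInfo_chan_noise μ σD σE measurable_snd (by simp)

end
end
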